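/- Let k ≥ 2 be an integer and let C be an orientation of the k-cycle. Then the following two assertions are equivalent: (1) for every ε > 0 there exists a constant c ≥ 1 such that every digraph D without loops or parallel arcs with χ(D) ≥ c and minimum out-degree at least ε·|V(D)| contains C as a subdigraph; (2) C consists of at least three blocks, or C consists of exactly two blocks, both of length at least two. -/

import Mathlib

/-- A digraph `D` (given by its arc relation `E`) contains the digraph given by the
arc relation `F` as a subdigraph: there is an injective map of the vertices preserving arcs. -/
def ContainsDigraph {V W : Type*} (E : V → V → Prop) (F : W → W → Prop) : Prop :=
  ∃ f : W → V, Function.Injective f ∧ ∀ u v : W, F u v → E (f u) (f v)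

/-- The orientation of the `k`-cycle determined by `o : ZMod k → Bool`:
the edge `i` of the cycle joins `i` and `i + 1`, and is oriented `i → i + 1`
when `o i = true`, and `i + 1 → i` when `o i = false`. -/
def cycleOrient {k : ℕ} (o : ZMod k → Bool) : ZMod k → ZMod k → Prop :=
  fun u v => (o u = true ∧ v = u + 1) ∨ (o v = false ∧ u = v + 1)

/-- The arc obtained by orienting the edge `i` of the `k`-cycle according to `o`.
Injectivity of `cycleArc o` says that distinct edges yield distinct arcs, i.e. the
orientation is a genuine digraph without parallel arcs (this is automatic for `k ≥ 3`). -/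
def cycleArc {k : ℕ} (o : ZMod k → Bool) (i : ZMod k) : ZMod k × ZMod k :=
  if o i then (i, i + 1) else (i + 1, i)

open Classical in
/-- The number of blocks of the orientation of the `k`-cycle given by `o`:
a directed cycle has a single block, and otherwise the blocks (maximal directed
subpaths) correspond bijectively to the indices `i` at which the orientation
changes between the consecutive edges `i` and `i + 1`. -/
noncomputable def blockCount {k : ℕ} (o : ZMod k → Bool) : ℕ :=
  if ∀ i, o i = o 0 then 1 else {i : ZMod k | o i ≠ o (i + 1)}.ncard

/-- The orientation of the `k`-cycle given by `o` has a block of length one, i.e.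
some edge `i + 1` is a maximal directed subpath on its own. -/
def hasShortBlock {k : ℕ} (o : ZMod k → Bool) : Prop :=
  ∃ i : ZMod k, o i ≠ o (i + 1) ∧ o (i + 1) ≠ o (i + 2)

section Helpers
open Classical

/-- `S` can be properly coloured with `c` colours. -/
def ColSet {V : Type} (E : V → V → Prop) (S : Finset V) (c : ℕ) : Prop :=
  ∃ f : V → ℕ, (∀ v ∈ S, f v < c) ∧ ∀ u ∈ S, ∀ v ∈ S, E u v → f u ≠ f v

/-- arc oriented according to a Boolean. -/
def arcB {V : Type} (E : V → V → Prop) (b : Bool) (u v : V) : Prop :=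
  if b = true then E u v else E v u

/-- `f 0, …, f m` is a path following the pattern `p`. -/
def IsPth {V : Type} (E : V → V → Prop) (p : ℕ → Bool) (m : ℕ) (f : ℕ → V) : Prop :=
  (∀ i < m, arcB E (p i) (f i) (f (i + 1))) ∧ ∀ i j, i ≤ m → j ≤ m → f i = f j → i = j

lemma ColSet.mono {V : Type} {E : V → V → Prop} {S T : Finset V} {a b : ℕ}
    (h : ColSet E T b) (hS : S ⊆ T) (hab : b ≤ a) : ColSet E S a := by
  obtain ⟨f, h1, h2⟩ := h
  exact ⟨f, fun v hv => (h1 v (hS hv)).trans_le hab,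
    fun u hu v hv => h2 u (hS hu) v (hS hv)⟩

lemma ColSet.union {V : Type} {E : V → V → Prop} {S T : Finset V} {a b : ℕ}
    (hS : ColSet E S a) (hT : ColSet E T b) : ColSet E (S ∪ T) (a + b) := by
  obtain ⟨f, h1, h2⟩ := hS
  obtain ⟨g, h3, h4⟩ := hT
  refine ⟨fun v => if v ∈ S then f v else a + g v, ?_, ?_⟩
  · intro v hv
    by_cases h : v ∈ S
    · simp only [h, if_true]; have := h1 v h; omega
    · have hv' : v ∈ T := by simpa [h] using hv
      simp only [h, if_false]; have := h3 v hv'; omega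
  · intro u hu v hv huv
    by_cases h : u ∈ S <;> by_cases h' : v ∈ S
    · simp only [h, h', if_true]; exact h2 u h v h' huv
    · simp only [h, h', if_true, if_false]; have := h1 u h; omega
    · simp only [h, h', if_true, if_false]; have := h1 v h'; omega
    · have hu' : u ∈ T := by simpa [h] using hu
      have hv' : v ∈ T := by simpa [h'] using hv
      simp only [h, h', if_false]; have := h4 u hu' v hv' huv; omega

lemma ColSet.empty {V : Type} (E : V → V → Prop) (c : ℕ) : ColSet E ∅ c :=
  ⟨fun _ => 0, by simp, by simp⟩

lemma ColSet.card {V : Type} {E : V → V → Prop} (irr : ∀ v, ¬ E v v) (S : Finset V) :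
    ColSet E S S.card := by
  induction S using Finset.induction_on with
  | empty => exact ColSet.empty _ _
  | insert a S ha ih =>
    rw [Finset.card_insert_of_notMem ha, Finset.insert_eq, add_comm]
    refine ColSet.union ⟨fun _ => 0, by simp, ?_⟩ ih
    intro u hu v hv huv
    simp only [Finset.mem_singleton] at hu hv
    subst hu; subst hv; exact absurd huv (irr _)

lemma ColSet.biUnion {V : Type} {E : V → V → Prop} {ι : Type} (I : Finset ι) (S : ι → Finset V)
    (c : ℕ) (h : ∀ i ∈ I, ColSet E (S i) c) : ColSet E (I.biUnion S) (I.card * c) := by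
  induction I using Finset.induction_on with
  | empty => simpa using ColSet.empty _ _
  | insert a I ha ih =>
    rw [Finset.card_insert_of_notMem ha, Finset.biUnion_insert, add_mul, one_mul, add_comm]
    exact ColSet.union (h a (by simp)) (ih fun i hi => h i (by simp [hi]))

lemma ColSet.flip {V : Type} {E : V → V → Prop} {S : Finset V} {c : ℕ}
    (h : ColSet (fun u v => E v u) S c) : ColSet E S c := by
  obtain ⟨f, h1, h2⟩ := h
  exact ⟨f, h1, fun u hu v hv huv => (h2 v hv u hu huv).symm⟩

/-- Digraphs with bounded out-degree are degenerate. -/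
lemma col_of_outdeg {V : Type} {E : V → V → Prop} (m : ℕ) (N : ℕ) :
    ∀ S : Finset V, S.card = N → (∀ v ∈ S, (S.filter (fun u => E v u)).card ≤ m) →
    (∀ v, ¬ E v v) → ColSet E S (2 * m + 1) := by
  induction N with
  | zero =>
    intro S hS _ _
    rw [Finset.card_eq_zero] at hS
    subst hS
    exact ColSet.empty _ _
  | succ N ih =>
    intro S hS hdeg irr
    have hne : S.Nonempty := by rw [← Finset.card_pos]; omega
    have hsum := Finset.sum_card_bipartiteAbove_eq_sum_card_bipartiteBelow (s := S) (t := S) E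
    have h1 : ∑ a ∈ S, (Finset.bipartiteAbove E S a).card ≤ ∑ a ∈ S, m :=
      Finset.sum_le_sum fun a ha => hdeg a ha
    rw [hsum] at h1
    obtain ⟨v, hv, hvm⟩ := Finset.exists_le_of_sum_le hne h1
    obtain ⟨f, hf1, hf2⟩ := ih (S.erase v) (by rw [Finset.card_erase_of_mem hv]; omega)
      (fun w hw => (Finset.card_le_card (Finset.filter_subset_filter _ (Finset.erase_subset _ _))).trans
        (hdeg w (Finset.mem_of_mem_erase hw))) irr
    set B := (S.filter (fun u => E v u) ∪ S.filter (fun u => E u v)).image f with hB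
    have hBc : B.card ≤ 2 * m := by
      refine Finset.card_image_le.trans ((Finset.card_union_le _ _).trans ?_)
      have := hdeg v hv
      have h3 : (S.filter (fun u => E u v)).card ≤ m := hvm
      omega
    obtain ⟨x, hx, hxB⟩ : ∃ x ∈ Finset.range (2 * m + 1), x ∉ B := by
      apply Finset.exists_mem_notMem_of_card_lt_card
      rw [Finset.card_range]; omega
    refine ⟨fun u => if u = v then x else f u, ?_, ?_⟩
    · intro u hu
      by_cases h : u = v
      · simpa [h] using hx
      · simp only [h, if_false]; exact hf1 u (Finset.mem_erase.2 ⟨h, hu⟩)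
    · intro u hu w hw huw
      by_cases h : u = v <;> by_cases h' : w = v
      · subst h; subst h'; exact absurd huw (irr _)
      · simp only [h, h', if_true, if_false]
        rintro rfl
        apply hxB
        subst h
        exact Finset.mem_image_of_mem _ (by simp [hw, huw])
      · simp only [h, h', if_true, if_false]
        intro hh
        apply hxB
        subst h'
        rw [← hh]
        exact Finset.mem_image_of_mem _ (by simp [hu, huw])
      · simp only [h, h', if_false]
        exact hf2 u (Finset.mem_erase.2 ⟨h, hu⟩) w (Finset.mem_erase.2 ⟨h', hw⟩) huw

lemma col_of_arcdeg {V : Type} {E : V → V → Prop} (irr : ∀ v, ¬ E v v) (b : Bool) (m : ℕ)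
    (S : Finset V) (h : ∀ v ∈ S, (S.filter (fun u => arcB E b v u)).card ≤ m) :
    ColSet E S (2 * m + 1) := by
  cases b with
  | true => exact col_of_outdeg m _ S rfl (by simpa [arcB] using h) irr
  | false =>
    exact ColSet.flip (col_of_outdeg m _ S rfl (by simpa [arcB] using h) irr)

/-- Every oriented path occurs in a digraph of large chromatic number. -/
lemma burr (p : ℕ → Bool) (m : ℕ) : ∃ c : ℕ, ∀ {V : Type} (E : V → V → Prop),
    (∀ v, ¬ E v v) → ∀ S : Finset V, ¬ ColSet E S c →
    ∃ f : ℕ → V, IsPth E p m f ∧ ∀ i ≤ m, f i ∈ S := by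
  induction m with
  | zero =>
    refine ⟨0, fun {V} E irr S hS => ?_⟩
    have : S.Nonempty := by
      rw [Finset.nonempty_iff_ne_empty]
      rintro rfl
      exact hS (ColSet.empty _ _)
    obtain ⟨x, hx⟩ := this
    exact ⟨fun _ => x, ⟨by simp, by intro i j hi hj _; omega⟩, fun _ _ => hx⟩
  | succ m ih =>
    obtain ⟨c, hc⟩ := ih
    refine ⟨c + (2 * m + 1), fun {V} E irr S hS => ?_⟩
    set S' := S.filter (fun v => m + 1 ≤ (S.filter (fun u => arcB E (p m) v u)).card) with hS'
    have h1 : ColSet E (S \ S') (2 * m + 1) := by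
      apply col_of_arcdeg irr (p m)
      intro v hv
      simp only [hS', Finset.mem_sdiff, Finset.mem_filter, not_and, not_le] at hv
      have := hv.2 hv.1
      have h2 := Finset.card_le_card (Finset.filter_subset_filter (fun u => arcB E (p m) v u)
        (Finset.sdiff_subset (s := S) (t := S')))
      omega
    have h2 : ¬ ColSet E S' c := by
      intro h
      apply hS
      exact (h.union h1).mono (by intro x hx; by_cases hx' : x ∈ S' <;> simp [hx, hx']) le_rfl
    obtain ⟨f, ⟨hf1, hf2⟩, hf3⟩ := hc E irr S' h2
    have h3 := hf3 m le_rfl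
    rw [hS', Finset.mem_filter] at h3
    obtain ⟨x, hx, hx'⟩ : ∃ x ∈ S.filter (fun u => arcB E (p m) (f m) u),
        x ∉ (Finset.range m).image f := by
      apply Finset.exists_mem_notMem_of_card_lt_card
      have := Finset.card_image_le (s := Finset.range m) (f := f)
      rw [Finset.card_range] at this
      omega
    rw [Finset.mem_filter] at hx
    have hxm : ∀ i ≤ m, f i ≠ x := by
      intro i hi hh
      rcases hi.lt_or_eq with h | h
      · exact hx' (Finset.mem_image.2 ⟨i, by simpa using h, hh⟩)
      · subst h
        have := hx.2
        rw [← hh] at this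
        unfold arcB at this
        split_ifs at this <;> exact irr _ this
    refine ⟨fun i => if i ≤ m then f i else x, ⟨?_, ?_⟩, ?_⟩
    · intro i hi
      rcases (Nat.lt_succ_iff.1 hi).lt_or_eq with h | h
      · have e1 : i ≤ m := h.le
        have e2 : i + 1 ≤ m := h
        simp only [e1, e2, if_true]
        exact hf1 i h
      · subst h
        simp only [le_refl, if_true, Nat.not_succ_le_self, if_false]
        exact hx.2
    · intro i j hi hj hij
      by_cases h : i ≤ m <;> by_cases h' : j ≤ m
      · simp only [h, h', if_true] at hij; exact hf2 i j h h' hij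
      · simp only [h, h', if_true, if_false] at hij; exact absurd hij (hxm i h)
      · simp only [h, h', if_true, if_false] at hij; exact absurd hij.symm (hxm j h')
      · omega
    · intro i hi
      by_cases h : i ≤ m
      · simp only [h, if_true]; exact (Finset.mem_filter.1 (hf3 i h)).1
      · simp only [h, if_false]; exact hx.1

/-- A closed injective walk of length `k` following pattern `p`. -/
def IsCyc {V : Type} (E : V → V → Prop) (p : ℕ → Bool) (k : ℕ) (g : ℕ → V) : Prop :=
  (∀ i < k, arcB E (p i) (g i) (g (i + 1))) ∧ g k = g 0 ∧
    ∀ i j, i < k → j < k → g i = g j → i = j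

/-- Out-neighbourhood. -/
noncomputable def outF {V : Type} [Fintype V] (E : V → V → Prop) (v : V) : Finset V :=
  Finset.univ.filter (fun u => E v u)

lemma mem_outF {V : Type} [Fintype V] {E : V → V → Prop} {v u : V} : u ∈ outF E v ↔ E v u := by
  simp [outF]

lemma glueA {V : Type} {E : V → V → Prop} {p : ℕ → Bool} {a b : ℕ}
    (p0 : p 0 = false) (p1 : p (a + 1) = true) (p2 : p (a + 2) = false) (p3 : p (a + b + 3) = true)
    {Q P : ℕ → V} (hQ : IsPth E (fun i => p (1 + i)) a Q) (hP : IsPth E (fun i => p (a + 3 + i)) b P)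
    (hQP : ∀ i j, i ≤ a → j ≤ b → Q i ≠ P j) {y1 y2 : V}
    (hy : y1 ≠ y2) (hy1Q : ∀ i ≤ a, Q i ≠ y1) (hy1P : ∀ i ≤ b, P i ≠ y1)
    (hy2Q : ∀ i ≤ a, Q i ≠ y2) (hy2P : ∀ i ≤ b, P i ≠ y2)
    (e1 : E (Q 0) y1) (e2 : E (Q a) y2) (e3 : E (P 0) y2) (e4 : E (P b) y1) :
    ∃ g, IsCyc E p (a + b + 4) g := by
  set g : ℕ → V := fun i => if i = 0 then y1 else if i ≤ a + 1 then Q (i - 1) else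
    if i = a + 2 then y2 else if i ≤ a + b + 3 then P (i - (a + 3)) else y1 with hg
  have g0 : g 0 = y1 := by simp [hg]
  have gQ : ∀ i ≤ a, g (i + 1) = Q i := by
    intro i hi
    simp [hg, hi]
  have g2 : g (a + 2) = y2 := by simp [hg]
  have gP : ∀ i ≤ b, g (a + 3 + i) = P i := by
    intro i hi
    have h1 : ¬ (a + 3 + i = 0) := by omega
    have h2 : ¬ (a + 3 + i ≤ a + 1) := by omega
    have h3 : ¬ (a + 3 + i = a + 2) := by omega
    have h4 : a + 3 + i ≤ a + b + 3 := by omega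
    simp only [hg, h1, h2, h3, h4, if_true, if_false]
    congr 1; omega
  have gk : g (a + b + 4) = y1 := by
    have h1 : ¬ (a + b + 4 = 0) := by omega
    have h2 : ¬ (a + b + 4 ≤ a + 1) := by omega
    have h3 : ¬ (a + b + 4 = a + 2) := by omega
    have h4 : ¬ (a + b + 4 ≤ a + b + 3) := by omega
    simp only [hg, h1, h2, h3, h4, if_false]
  have cases4 : ∀ i < a + b + 4, i = 0 ∨ (∃ j ≤ a, i = j + 1) ∨ i = a + 2 ∨
      ∃ j ≤ b, i = a + 3 + j := by
    intro i hi
    by_cases h1 : i = 0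
    · exact Or.inl h1
    by_cases h2 : i ≤ a + 1
    · exact Or.inr (Or.inl ⟨i - 1, by omega, by omega⟩)
    by_cases h3 : i = a + 2
    · exact Or.inr (Or.inr (Or.inl h3))
    · exact Or.inr (Or.inr (Or.inr ⟨i - (a + 3), by omega, by omega⟩))
  refine ⟨g, ?_, by rw [gk, g0], ?_⟩
  · intro i hi
    rcases cases4 i hi with rfl | ⟨j, hj, rfl⟩ | rfl | ⟨j, hj, rfl⟩
    · rw [g0, gQ 0 (by omega), p0]; simpa [arcB] using e1
    · rcases hj.lt_or_eq with h | h
      · rw [gQ j hj, gQ (j + 1) h]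
        have := hQ.1 j h
        simpa only [add_comm 1 j] using this
      · subst h
        rw [gQ j hj, g2, p1]; simpa [arcB] using e2
    · have := gP 0 (by omega)
      rw [g2, show a + 2 + 1 = a + 3 + 0 by omega, this, p2]; simpa [arcB] using e3
    · rcases hj.lt_or_eq with h | h
      · rw [gP j hj, add_assoc (a + 3), gP (j + 1) h]
        exact hP.1 j h
      · subst h
        rw [gP j hj, show a + 3 + j + 1 = a + j + 4 by omega, gk,
          show a + 3 + j = a + j + 3 by omega, p3]; simpa [arcB] using e4
  · intro i i' hi hi' h
    have cases5 : ∀ i < a + b + 4, (i = 0 ∧ g i = y1) ∨ (∃ j ≤ a, i = j + 1 ∧ g i = Q j) ∨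
        (i = a + 2 ∧ g i = y2) ∨ ∃ j ≤ b, i = a + 3 + j ∧ g i = P j := by
      intro i hi
      rcases cases4 i hi with rfl | ⟨j, hj, rfl⟩ | rfl | ⟨j, hj, rfl⟩
      · exact Or.inl ⟨rfl, g0⟩
      · exact Or.inr (Or.inl ⟨j, hj, rfl, gQ j hj⟩)
      · exact Or.inr (Or.inr (Or.inl ⟨rfl, g2⟩))
      · exact Or.inr (Or.inr (Or.inr ⟨j, hj, rfl, gP j hj⟩))
    rcases cases5 i hi with ⟨rfl, e⟩ | ⟨j, hj, rfl, e⟩ | ⟨rfl, e⟩ | ⟨j, hj, rfl, e⟩ <;>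
    rcases cases5 i' hi' with ⟨rfl, e'⟩ | ⟨j', hj', rfl, e'⟩ | ⟨rfl, e'⟩ | ⟨j', hj', rfl, e'⟩ <;>
    replace h := e.symm.trans (h.trans e')
    · rfl
    · exact absurd h.symm (hy1Q _ hj')
    · exact absurd h hy
    · exact absurd h.symm (hy1P _ hj')
    · exact absurd h (hy1Q _ hj)
    · rw [hQ.2 _ _ hj hj' h]
    · exact absurd h (hy2Q _ hj)
    · exact absurd h (hQP _ _ hj hj')
    · exact absurd h.symm hy
    · exact absurd h.symm (hy2Q _ hj')
    · rfl
    · exact absurd h.symm (hy2P _ hj')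
    · exact absurd h (hy1P _ hj)
    · exact absurd h.symm (hQP _ _ hj' hj)
    · exact absurd h (hy2P _ hj)
    · rw [hP.2 _ _ hj hj' h]

lemma card_union_bound {V : Type} {ι : Type} (A : ι → Finset V) (W : Finset ι) (x t : ℕ)
    (hx : ∀ w ∈ W, x ≤ (A w).card)
    (ht : ∀ w ∈ W, ∀ w' ∈ W, w ≠ w' → (A w ∩ A w').card ≤ t) :
    W.card * x ≤ (W.biUnion A).card + W.card * W.card * t := by
  induction W using Finset.induction_on with
  | empty => simp
  | insert a W ha ih =>
    have ih' := ih (fun w hw => hx w (by simp [hw]))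
      (fun w hw w' hw' => ht w (by simp [hw]) w' (by simp [hw']))
    rw [Finset.card_insert_of_notMem ha, Finset.biUnion_insert]
    have h1 := Finset.card_union_add_card_inter (A a) (W.biUnion A)
    have h2 : (A a ∩ W.biUnion A).card ≤ W.card * t := by
      rw [Finset.inter_biUnion]
      apply Finset.card_biUnion_le_card_mul
      intro w hw
      exact ht a (by simp) w (by simp [hw]) (by rintro rfl; exact ha hw)
    have h3 := hx a (by simp)
    nlinarith

lemma caseA_step {V : Type} [Fintype V] {E : V → V → Prop} (irr : ∀ v, ¬ E v v)
    {p : ℕ → Bool} {a b : ℕ}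
    (p0 : p 0 = false) (p1 : p (a + 1) = true) (p2 : p (a + 2) = false) (p3 : p (a + b + 3) = true)
    {cQ cP : ℕ}
    (hcQ : ∀ S : Finset V, ¬ ColSet E S cQ →
      ∃ f : ℕ → V, IsPth E (fun i => p (1 + i)) a f ∧ ∀ i ≤ a, f i ∈ S)
    (hcP : ∀ S : Finset V, ¬ ColSet E S cP →
      ∃ f : ℕ → V, IsPth E (fun i => p (a + 3 + i)) b f ∧ ∀ i ≤ b, f i ∈ S)
    (hno : ¬ ∃ g, IsCyc E p (a + b + 4) g) (x : ℕ) (U : Finset V)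
    (hU : ¬ ColSet E U (cQ + ((a + 1) + (cP + (x + x))))) :
    ∃ w ∈ U, ∃ U' ⊆ U, ¬ ColSet E U' x ∧ ∀ u ∈ U', (outF E w ∩ outF E u).card ≤ a + b + 4 := by
  by_contra hcon
  push Not at hcon
  apply hU
  by_cases hQc : ColSet E U cQ
  · exact hQc.mono le_rfl (by omega)
  obtain ⟨Q, hQ, hQU⟩ := hcQ U hQc
  set R := (Finset.range (a + 1)).image Q with hR
  have hRc : R.card ≤ a + 1 := by
    simpa using Finset.card_image_le (s := Finset.range (a + 1)) (f := Q)
  have hRcol : ColSet E R (a + 1) := (ColSet.card irr R).mono le_rfl hRc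
  have hbig : ∀ w ∈ U, ColSet E (U.filter fun u => (outF E w ∩ outF E u).card ≤ a + b + 4) x := by
    intro w hw
    by_contra h
    obtain ⟨u, hu, hu'⟩ := hcon w hw _ (Finset.filter_subset _ _) h
    have := (Finset.mem_filter.1 hu).2
    omega
  set G := (U \ R).filter fun u => a + b + 4 < (outF E (Q 0) ∩ outF E u).card ∧
    a + b + 4 < (outF E (Q a) ∩ outF E u).card with hG
  have hGcol : ColSet E G cP := by
    by_contra h
    obtain ⟨P, hP, hPG⟩ := hcP G h
    apply hno
    set R' := (Finset.range (b + 1)).image P with hR'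
    have hRc' : R'.card ≤ b + 1 := by
      simpa using Finset.card_image_le (s := Finset.range (b + 1)) (f := P)
    have hb := (Finset.mem_filter.1 (hPG b le_rfl)).2.1
    have h0 := (Finset.mem_filter.1 (hPG 0 (by omega))).2.2
    have hRR : (R ∪ R').card ≤ a + b + 2 := (Finset.card_union_le _ _).trans (by omega)
    obtain ⟨y1, hy1, hy1'⟩ := Finset.exists_mem_notMem_of_card_lt_card
      (s := R ∪ R') (t := outF E (Q 0) ∩ outF E (P b)) (by omega)
    obtain ⟨y2, hy2, hy2'⟩ := Finset.exists_mem_notMem_of_card_lt_card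
      (s := insert y1 (R ∪ R')) (t := outF E (Q a) ∩ outF E (P 0))
      (by have := Finset.card_insert_le y1 (R ∪ R'); omega)
    rw [Finset.mem_inter, mem_outF, mem_outF] at hy1 hy2
    have hmQ : ∀ i ≤ a, Q i ∈ R := fun i hi =>
      Finset.mem_image_of_mem _ (Finset.mem_range.2 (by omega))
    have hmP : ∀ i ≤ b, P i ∈ R' := fun i hi =>
      Finset.mem_image_of_mem _ (Finset.mem_range.2 (by omega))
    simp only [Finset.mem_insert, Finset.mem_union, not_or] at hy1' hy2'
    refine glueA p0 p1 p2 p3 hQ hP ?_ (Ne.symm hy2'.1) ?_ ?_ ?_ ?_ hy1.1 hy2.1 hy2.2 hy1.2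
    · intro i j hi hj hij
      have := (Finset.mem_sdiff.1 (Finset.mem_filter.1 (hPG j hj)).1).2
      rw [← hij] at this
      exact this (hmQ i hi)
    · rintro i hi rfl; exact hy1'.1 (hmQ i hi)
    · rintro i hi rfl; exact hy1'.2 (hmP i hi)
    · rintro i hi rfl; exact hy2'.2.1 (hmQ i hi)
    · rintro i hi rfl; exact hy2'.2.2 (hmP i hi)
  refine (hRcol.union (hGcol.union ((hbig _ (hQU 0 (by omega))).union
    (hbig _ (hQU a le_rfl))))).mono ?_ (by omega)
  intro u hu
  simp only [hG, Finset.mem_union, Finset.mem_filter, Finset.mem_sdiff]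
  by_cases h1 : u ∈ R
  · exact Or.inl h1
  by_cases h2 : (outF E (Q 0) ∩ outF E u).card ≤ a + b + 4
  · exact Or.inr (Or.inr (Or.inl ⟨hu, h2⟩))
  by_cases h3 : (outF E (Q a) ∩ outF E u).card ≤ a + b + 4
  · exact Or.inr (Or.inr (Or.inr ⟨hu, h3⟩))
  · exact Or.inr (Or.inl ⟨⟨hu, h1⟩, by omega, by omega⟩)

lemma iter_step {V : Type} [Fintype V] {E : V → V → Prop} (t : ℕ)
    (hbig : ∀ v, t < (outF E v).card) (G : ℕ → ℕ)
    (hstep : ∀ x (U : Finset V), ¬ ColSet E U (G x) →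
      ∃ w ∈ U, ∃ U' ⊆ U, ¬ ColSet E U' x ∧ ∀ u ∈ U', (outF E w ∩ outF E u).card ≤ t) (N : ℕ) :
    ∀ U : Finset V, ¬ ColSet E U (G^[N] 0) → ∃ W ⊆ U, W.card = N ∧
      ∀ w ∈ W, ∀ w' ∈ W, w ≠ w' → (outF E w ∩ outF E w').card ≤ t := by
  induction N with
  | zero => intro U _; exact ⟨∅, by simp, by simp, by simp⟩
  | succ N ih =>
    intro U hU
    rw [Function.iterate_succ_apply'] at hU
    obtain ⟨w, hw, U', hU', hc, hu⟩ := hstep _ U hU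
    obtain ⟨W, hWU, hWc, hW⟩ := ih U' hc
    have hwW : w ∉ W := by
      intro h
      have h1 := hu w (hWU h)
      rw [Finset.inter_self] at h1
      have := hbig w
      omega
    refine ⟨insert w W, ?_, ?_, ?_⟩
    · intro z hz
      rcases Finset.mem_insert.1 hz with rfl | h
      · exact hw
      · exact hU' (hWU h)
    · rw [Finset.card_insert_of_notMem hwW, hWc]
    · intro z hz z' hz' hne
      rcases Finset.mem_insert.1 hz with rfl | h <;> rcases Finset.mem_insert.1 hz' with rfl | h'
      · exact absurd rfl hne
      · exact hu _ (hWU h')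
      · rw [Finset.inter_comm]; exact hu _ (hWU h)
      · exact hW z h z' h' hne

lemma caseA {p : ℕ → Bool} {a b : ℕ}
    (p0 : p 0 = false) (p1 : p (a + 1) = true) (p2 : p (a + 2) = false) (p3 : p (a + b + 3) = true)
    {ε : ℝ} (hε : 0 < ε) : ∃ c : ℕ, ∀ (n : ℕ) (E : Fin n → Fin n → Prop), (∀ v, ¬ E v v) →
      ¬ ColSet E Finset.univ c → (∀ v, ε * (n : ℝ) ≤ ((outF E v).card : ℝ)) →
      ∃ g, IsCyc E p (a + b + 4) g := by
  obtain ⟨cQ, hcQ⟩ := burr (fun i => p (1 + i)) a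
  obtain ⟨cP, hcP⟩ := burr (fun i => p (a + 3 + i)) b
  obtain ⟨N, hN⟩ := exists_nat_gt (2 / ε)
  obtain ⟨M, hM⟩ := exists_nat_gt ((a + b + 4 : ℕ) / ε)
  set G : ℕ → ℕ := fun x => cQ + ((a + 1) + (cP + (x + x))) with hG
  refine ⟨G^[N] 0 + N * N * (a + b + 4) + M, ?_⟩
  intro n E irr hcol hdeg
  have hn : G^[N] 0 + N * N * (a + b + 4) + M < n := by
    by_contra h
    exact hcol ((ColSet.card irr _).mono le_rfl (by simp; omega))
  by_contra hno
  have hNε : 2 < N * ε := by rwa [div_lt_iff₀ hε] at hN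
  have hMε : ((a + b + 4 : ℕ) : ℝ) < M * ε := by rwa [div_lt_iff₀ hε] at hM
  have hMn : (M : ℝ) ≤ n := by exact_mod_cast (by omega : M ≤ n)
  obtain ⟨W, -, hWc, hW⟩ := iter_step (E := E) (a + b + 4) (by
      intro v
      have h1 := hdeg v
      have : ((a + b + 4 : ℕ) : ℝ) < ((outF E v).card : ℝ) := by nlinarith
      exact_mod_cast this) G
    (fun x U hU => caseA_step irr p0 p1 p2 p3 (hcQ E irr) (hcP E irr) hno x U hU) N Finset.univ
    (fun h => hcol (h.mono le_rfl (by omega)))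
  have hb := card_union_bound (outF E) W (⌈ε * n⌉₊) (a + b + 4)
    (fun w _ => Nat.ceil_le.2 (hdeg w)) hW
  rw [hWc] at hb
  replace hb := hb.trans (Nat.add_le_add_right (Finset.card_le_univ _) _)
  rw [Fintype.card_fin] at hb
  have h1 : N * ⌈ε * n⌉₊ < 2 * n := by omega
  have h2 : ((N * ⌈ε * n⌉₊ : ℕ) : ℝ) < ((2 * n : ℕ) : ℝ) := by exact_mod_cast h1
  push_cast at h2
  have h3 := Nat.le_ceil (ε * n)
  have h4 : (0 : ℝ) ≤ N := by positivity
  have h5 : (0 : ℝ) ≤ n := by positivity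
  nlinarith [mul_le_mul_of_nonneg_left h3 h4]

lemma glueB {V : Type} {E : V → V → Prop} {p : ℕ → Bool} {a b : ℕ} (ha : 1 ≤ a) (hb : 1 ≤ b)
    (pT : ∀ i < a, p i = true) (pF : ∀ i, a ≤ i → i < a + b → p i = false)
    {f h : ℕ → V} (hf : IsPth E (fun _ => true) a f) (hh : IsPth E (fun _ => true) b h)
    (h0 : f 0 = h 0) (h1 : f a = h b) (hd : ∀ i j, i ≤ a → 1 ≤ j → j < b → f i ≠ h j) :
    ∃ g, IsCyc E p (a + b) g := by
  set g : ℕ → V := fun i => if i ≤ a then f i else h (a + b - i) with hg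
  have g1 : ∀ i ≤ a, g i = f i := by intro i hi; simp [hg, hi]
  have g2 : ∀ i, a ≤ i → g i = h (a + b - i) := by
    intro i hi
    rcases hi.lt_or_eq with h' | rfl
    · simp [hg, not_le.2 h']
    · rw [g1 _ le_rfl, h1]; congr 1; omega
  refine ⟨g, ?_, ?_, ?_⟩
  · intro i hi
    by_cases h' : i < a
    · rw [g1 i h'.le, g1 (i + 1) h', pT i h']; exact hf.1 i h'
    · rw [g2 i (by omega), g2 (i + 1) (by omega), pF i (by omega) hi]
      have := hh.1 (a + b - (i + 1)) (by omega)
      rw [show a + b - (i + 1) + 1 = a + b - i by omega] at this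
      simpa [arcB] using this
  · rw [g2 _ (by omega), g1 0 (by omega), h0]; congr 1; omega
  · intro i j hi hj hij
    by_cases hi' : i ≤ a <;> by_cases hj' : j ≤ a
    · rw [g1 i hi', g1 j hj'] at hij; exact hf.2 i j hi' hj' hij
    · rw [g1 i hi', g2 j (by omega)] at hij
      exact absurd hij (hd _ _ hi' (by omega) (by omega))
    · rw [g2 i (by omega), g1 j hj'] at hij
      exact absurd hij.symm (hd _ _ hj' (by omega) (by omega))
    · rw [g2 i (by omega), g2 j (by omega)] at hij
      have := hh.2 _ _ (by omega) (by omega) hij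
      omega

/-- `y` can be reached robustly from `u` by directed paths of length `j`. -/
def Rob {V : Type} (E : V → V → Prop) (j : ℕ) (u y : V) (t : ℕ) : Prop :=
  ∀ F : Finset V, F.card ≤ t → u ∉ F → y ∉ F → ∃ f : ℕ → V, f 0 = u ∧ f j = y ∧
    IsPth E (fun _ => true) j f ∧ ∀ i ≤ j, f i ∉ F

lemma rob_step {V : Type} [Fintype V] {E : V → V → Prop} (irr : ∀ v, ¬ E v v)
    (Y Z : Finset V) (j t : ℕ) (u : V) (hu : u ∉ Y)
    (hbig : Y.card * t + Y.card < (outF E u ∩ Z).card)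
    (hZ : ∀ a ∈ Z, a ∉ Y → ∃ y ∈ Y, Rob E j a y (t + 1)) : ∃ y ∈ Y, Rob E (j + 1) u y t := by
  have h1 : Y.card * t < ((outF E u ∩ Z) \ Y).card := by
    have := Finset.le_card_sdiff Y (outF E u ∩ Z)
    omega
  have h2 : ∀ a : V, ∃ y, a ∈ (outF E u ∩ Z) \ Y → y ∈ Y ∧ Rob E j a y (t + 1) := by
    intro a
    by_cases ha : a ∈ (outF E u ∩ Z) \ Y
    · simp only [Finset.mem_sdiff, Finset.mem_inter] at ha
      obtain ⟨y, hy, hy'⟩ := hZ a ha.1.2 ha.2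
      exact ⟨y, fun _ => ⟨hy, hy'⟩⟩
    · exact ⟨a, fun h => absurd h ha⟩
  choose φ hφ using h2
  obtain ⟨y, hy, hy'⟩ := Finset.exists_lt_card_fiber_of_mul_lt_card_of_maps_to
    (fun a ha => (hφ a ha).1) h1
  refine ⟨y, hy, ?_⟩
  intro F hF huF hyF
  obtain ⟨a, ha, haF⟩ := Finset.exists_mem_notMem_of_card_lt_card (hF.trans_lt hy')
  rw [Finset.mem_filter] at ha
  have hR := (hφ a ha.1).2
  rw [ha.2] at hR
  have hua : E u a := by
    have := ha.1
    simp only [Finset.mem_sdiff, Finset.mem_inter, mem_outF] at this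
    exact this.1.1
  obtain ⟨f, f0, fj, ⟨fp1, fp2⟩, fF⟩ := hR (insert u F)
    ((Finset.card_insert_le _ _).trans (by omega))
    (by
      rw [Finset.mem_insert, not_or]
      exact ⟨by rintro rfl; exact irr _ hua, haF⟩)
    (by
      rw [Finset.mem_insert, not_or]
      exact ⟨by rintro rfl; exact hu hy, hyF⟩)
  have fu : ∀ i ≤ j, f i ≠ u := fun i hi h => fF i hi (by simp [h])
  refine ⟨fun i => if i = 0 then u else f (i - 1), by simp, by simpa using fj, ⟨?_, ?_⟩, ?_⟩
  · intro i hi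
    rcases Nat.eq_zero_or_pos i with rfl | h
    · simpa [arcB, f0] using hua
    · have e1 : i ≠ 0 := by omega
      have := fp1 (i - 1) (by omega)
      rw [show i - 1 + 1 = i by omega] at this
      simpa [e1] using this
  · intro i i' hi hi' h
    by_cases e1 : i = 0 <;> by_cases e2 : i' = 0
    · omega
    · simp only [e1, e2, if_true, if_false] at h
      exact absurd h.symm (fu _ (by omega))
    · simp only [e1, e2, if_true, if_false] at h
      exact absurd h (fu _ (by omega))
    · simp only [e1, e2, if_false] at h
      have := fp2 _ _ (by omega) (by omega) h
      omega
  · intro i hi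
    by_cases e1 : i = 0
    · simpa [e1] using huF
    · simp only [e1, if_false]
      intro h
      exact fF (i - 1) (by omega) (by simp [h])

lemma cover {V : Type} [Fintype V] {n : ℕ} (hV : Fintype.card V = n) {E : V → V → Prop} {ε : ℝ} (hε1 : ε ≤ 1)
    (hdeg : ∀ v, ε * (n : ℝ) ≤ ((outF E v).card : ℝ)) (j : ℕ) :
    ∃ Y : Finset (V), Y.card ≤ j ∧
      ((Finset.univ.filter (fun a => ∀ y ∈ Y, ¬ E a y)).card : ℝ) ≤ (1 - ε) ^ j * n := by
  induction j with
  | zero =>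
    refine ⟨∅, by simp, by simp [hV]⟩
  | succ j ih =>
    obtain ⟨Y, hY, hc⟩ := ih
    set R := Finset.univ.filter (fun a => ∀ y ∈ Y, ¬ E a y) with hR
    rcases R.eq_empty_or_nonempty with h | ⟨r, hr⟩
    · refine ⟨Y, by omega, ?_⟩
      rw [← hR, h]
      simp only [Finset.card_empty, Nat.cast_zero]
      have : (0 : ℝ) ≤ 1 - ε := by linarith
      positivity
    · have hsum := Finset.sum_card_bipartiteAbove_eq_sum_card_bipartiteBelow (s := R)
        (t := Finset.univ) E
      have h1 : (R.card : ℝ) * (ε * n) ≤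
          ∑ y : V, ((Finset.bipartiteBelow E R y).card : ℝ) := by
        have : ∑ a ∈ R, (ε * n) ≤ ∑ a ∈ R, ((Finset.bipartiteAbove E Finset.univ a).card : ℝ) :=
          Finset.sum_le_sum fun a _ => hdeg a
        rw [Finset.sum_const, nsmul_eq_mul] at this
        refine this.trans (le_of_eq ?_)
        exact_mod_cast hsum
      have h2 : ∑ y : V, (ε * R.card) ≤
          ∑ y : V, ((Finset.bipartiteBelow E R y).card : ℝ) := by
        refine le_trans (le_of_eq ?_) h1
        simp [hV]; ring
      obtain ⟨y, -, hy⟩ := Finset.exists_le_of_sum_le ⟨r, Finset.mem_univ r⟩ h2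
      refine ⟨insert y Y, (Finset.card_insert_le _ _).trans (by omega), ?_⟩
      have h3 : Finset.univ.filter (fun a => ∀ z ∈ insert y Y, ¬ E a z) =
          R.filter (fun a => ¬ E a y) := by
        ext a
        simp [hR]
        tauto
      have h4 := Finset.card_filter_add_card_filter_not (s := R) (fun a => E a y)
      have h5 : (((R.filter (fun a => E a y)).card : ℝ)) + ((R.filter (fun a => ¬ E a y)).card : ℝ)
          = R.card := by exact_mod_cast h4
      have h6 : ε * R.card ≤ ((R.filter (fun a => E a y)).card : ℝ) := hy
      have h7 : ((Finset.univ.filter (fun a => ∀ z ∈ insert y Y, ¬ E a z)).card : ℝ) =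
          ((R.filter (fun a => ¬ E a y)).card : ℝ) := by
        congr 2
      refine (le_of_eq h7).trans ?_
      rw [pow_succ]
      have h8 : (1 - ε) * R.card ≤ (1 - ε) * ((1 - ε) ^ j * n) :=
        mul_le_mul_of_nonneg_left hc (by linarith)
      nlinarith

lemma rob_all {V : Type} [Fintype V] {n : ℕ} {E : V → V → Prop} (irr : ∀ v, ¬ E v v) {ε : ℝ}
    (hdeg : ∀ v, ε * (n : ℝ) ≤ ((outF E v).card : ℝ)) (Y : Finset (V)) (T : ℕ)
    (hY : ((Finset.univ.filter (fun a => ∀ y ∈ Y, ¬ E a y)).card : ℝ) ≤ ε / 2 * n)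
    (hn : (Y.card * T + Y.card : ℕ) < ε / 2 * n) (j : ℕ) :
    ∀ t, t + j ≤ T → ∀ u ∉ Y, ∃ y ∈ Y, Rob E (j + 2) u y t := by
  induction j with
  | zero =>
    intro t ht u hu
    refine rob_step irr Y (Finset.univ.filter (fun a => ∃ y ∈ Y, E a y)) 1 t u hu ?_ ?_
    · have h1 : outF E u ⊆ (outF E u ∩ Finset.univ.filter (fun a => ∃ y ∈ Y, E a y)) ∪
          Finset.univ.filter (fun a => ∀ y ∈ Y, ¬ E a y) := by
        intro a ha
        by_cases h : ∃ y ∈ Y, E a y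
        · exact Finset.mem_union_left _ (Finset.mem_inter.2 ⟨ha, by simpa using h⟩)
        · refine Finset.mem_union_right _ ?_
          push Not at h
          simpa using h
      have h2 := (Finset.card_le_card h1).trans (Finset.card_union_le _ _)
      have h3 : ((outF E u).card : ℝ) ≤
        ((outF E u ∩ Finset.univ.filter (fun a => ∃ y ∈ Y, E a y)).card : ℝ) +
        ((Finset.univ.filter (fun a => ∀ y ∈ Y, ¬ E a y)).card : ℝ) := by exact_mod_cast h2
      have h4 := hdeg u
      have h5 : ((Y.card * T + Y.card : ℕ) : ℝ) <
        ((outF E u ∩ Finset.univ.filter (fun a => ∃ y ∈ Y, E a y)).card : ℝ) := by linarith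
      have h6 : Y.card * T + Y.card <
        (outF E u ∩ Finset.univ.filter (fun a => ∃ y ∈ Y, E a y)).card := by exact_mod_cast h5
      have h7 : Y.card * t ≤ Y.card * T := Nat.mul_le_mul_left _ (by omega)
      omega
    · intro a ha haY
      obtain ⟨y, hy, hay⟩ := (Finset.mem_filter.1 ha).2
      refine ⟨y, hy, fun F _ haF hyF => ⟨fun i => if i = 0 then a else y, by simp, by simp,
        ⟨?_, ?_⟩, ?_⟩⟩
      · intro i hi
        have : i = 0 := by omega
        subst this
        simpa [arcB] using hay
      · have hne : a ≠ y := by rintro rfl; exact irr _ hay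
        intro i i' hi hi' h
        by_cases e1 : i = 0 <;> by_cases e2 : i' = 0
        · omega
        · simp [e1, e2] at h; exact absurd h hne
        · simp [e1, e2] at h; exact absurd h.symm hne
        · omega
      · intro i hi
        by_cases e1 : i = 0
        · simpa [e1] using haF
        · simpa [e1] using hyF
  | succ j ih =>
    intro t ht u hu
    refine rob_step irr Y Finset.univ (j + 2) t u hu ?_ ?_
    · have h4 := hdeg u
      have h0 : (0 : ℝ) ≤ ((Y.card * T + Y.card : ℕ) : ℝ) := by positivity
      have h5 : ((Y.card * T + Y.card : ℕ) : ℝ) < ((outF E u).card : ℝ) := by linarith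
      have h6 : Y.card * T + Y.card < (outF E u).card := by exact_mod_cast h5
      have h7 : Y.card * t ≤ Y.card * T := Nat.mul_le_mul_left _ (by omega)
      rw [Finset.inter_univ]
      omega
    · intro a _ ha
      exact ih (t + 1) (by omega) a ha

/-- two internally disjoint directed paths with lengths `p + 2` and `p + 2 + d`. -/
lemma two_paths (p d : ℕ) {ε : ℝ} (hε : 0 < ε) : ∃ c : ℕ, ∀ {V : Type} [Fintype V] (n : ℕ) (_ : Fintype.card V = n) (E : V → V → Prop),
    (∀ v, ¬ E v v) →
      ¬ ColSet E Finset.univ c → (∀ v, ε * (n : ℝ) ≤ ((outF E v).card : ℝ)) →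
      ∃ f h : ℕ → V, IsPth E (fun _ => true) (p + 2) f ∧
        IsPth E (fun _ => true) (p + 2 + d) h ∧ f 0 = h 0 ∧ f (p + 2) = h (p + 2 + d) ∧
        ∀ i j, i ≤ p + 2 → 1 ≤ j → j < p + 2 + d → f i ≠ h j := by
  obtain ⟨cB, hcB⟩ := burr (fun _ => true) d
  set ε' := min ε 1 with hε'
  have hε'0 : 0 < ε' := lt_min hε one_pos
  obtain ⟨s, hs⟩ := exists_pow_lt_of_lt_one (show 0 < ε' / 2 by positivity)
    (show 1 - ε' < 1 by linarith)
  set T := d + p + 2 + p with hT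
  obtain ⟨M, hM⟩ := exists_nat_gt ((s * T + s : ℕ) / (ε' / 2))
  refine ⟨s + s * cB + M, ?_⟩
  intro V _ n hV E irr hcol hdeg0
  have hdeg : ∀ v, ε' * (n : ℝ) ≤ ((outF E v).card : ℝ) := fun v =>
    (mul_le_mul_of_nonneg_right (min_le_left _ _) (by positivity)).trans (hdeg0 v)
  have hn : s + s * cB + M < n := by
    by_contra h
    exact hcol ((ColSet.card irr _).mono le_rfl (by simp [hV]; omega))
  obtain ⟨Y, hYs, hYc⟩ := cover hV (E := E) (min_le_right ε 1) hdeg s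
  have hY : ((Finset.univ.filter (fun a => ∀ y ∈ Y, ¬ E a y)).card : ℝ) ≤ ε' / 2 * n :=
    hYc.trans (mul_le_mul_of_nonneg_right hs.le (by positivity))
  have hbig : ((Y.card * T + Y.card : ℕ) : ℝ) < ε' / 2 * n := by
    rw [div_lt_iff₀ (by positivity)] at hM
    have h1 : Y.card * T + Y.card ≤ s * T + s :=
      Nat.add_le_add (Nat.mul_le_mul_right _ hYs) hYs
    have h2 : ((Y.card * T + Y.card : ℕ) : ℝ) ≤ ((s * T + s : ℕ) : ℝ) := by exact_mod_cast h1
    have h3 : (M : ℝ) ≤ n := by exact_mod_cast (by omega : M ≤ n)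
    have h4 : M * (ε' / 2) ≤ n * (ε' / 2) := mul_le_mul_of_nonneg_right h3 (by positivity)
    linarith
  have hrob := rob_all irr hdeg Y T hY hbig p (d + p + 2) (by omega)
  obtain ⟨y, hyY, hyc⟩ : ∃ y ∈ Y, ¬ ColSet E
      (Finset.univ.filter (fun u => u ∉ Y ∧ Rob E (p + 2) u y (d + p + 2))) cB := by
    by_contra hcon
    push Not at hcon
    apply hcol
    refine ((ColSet.card irr Y).union (ColSet.biUnion Y _ cB hcon)).mono ?_ ?_
    · intro u _
      by_cases hu : u ∈ Y
      · exact Finset.mem_union_left _ hu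
      · obtain ⟨y, hy, hy'⟩ := hrob u hu
        exact Finset.mem_union_right _ (Finset.mem_biUnion.2 ⟨y, hy, by simp [hu, hy']⟩)
    · have := Nat.mul_le_mul_right cB hYs
      omega
  obtain ⟨X, ⟨hX1, hX2⟩, hXS⟩ := hcB E irr _ hyc
  have hXY : ∀ i ≤ d, X i ∉ Y := fun i hi => (Finset.mem_filter.1 (hXS i hi)).2.1
  have hXR : ∀ i ≤ d, Rob E (p + 2) (X i) y (d + p + 2) :=
    fun i hi => (Finset.mem_filter.1 (hXS i hi)).2.2
  have hXy : ∀ i ≤ d, X i ≠ y := by rintro i hi rfl; exact hXY i hi hyY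
  set F1 := (Finset.Icc 1 d).image X with hF1
  obtain ⟨f, f0, fp, ⟨fa, fi⟩, fF⟩ := hXR 0 (by omega) F1
    (Finset.card_image_le.trans (by simp; omega))
    (by
      intro h
      obtain ⟨i, hi, h⟩ := Finset.mem_image.1 h
      rw [Finset.mem_Icc] at hi
      have := hX2 _ _ hi.2 (by omega) h
      omega)
    (by
      intro h
      obtain ⟨i, hi, h⟩ := Finset.mem_image.1 h
      rw [Finset.mem_Icc] at hi
      exact hXy _ hi.2 h)
  have hF1m : ∀ i, 1 ≤ i → i ≤ d → X i ∈ F1 := fun i h1 h2 =>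
    Finset.mem_image_of_mem _ (Finset.mem_Icc.2 ⟨h1, h2⟩)
  set F2 := (Finset.range d).image X ∪ (Finset.Icc 1 (p + 1)).image f with hF2
  have hF2X : ∀ i < d, X i ∈ F2 := fun i h =>
    Finset.mem_union_left _ (Finset.mem_image_of_mem _ (Finset.mem_range.2 h))
  have hF2f : ∀ i, 1 ≤ i → i ≤ p + 1 → f i ∈ F2 := fun i h1 h2 =>
    Finset.mem_union_right _ (Finset.mem_image_of_mem _ (Finset.mem_Icc.2 ⟨h1, h2⟩))
  obtain ⟨h, h0, hp, ⟨ha, hi⟩, hF⟩ := hXR d le_rfl F2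
    (by
      refine (Finset.card_union_le _ _).trans ?_
      have e1 := Finset.card_image_le (s := Finset.range d) (f := X)
      have e2 := Finset.card_image_le (s := Finset.Icc 1 (p + 1)) (f := f)
      simp only [Finset.card_range, Nat.card_Icc] at e1 e2
      omega)
    (by
      intro h
      rcases Finset.mem_union.1 h with h | h
      · obtain ⟨i, hi, h⟩ := Finset.mem_image.1 h
        rw [Finset.mem_range] at hi
        have := hX2 _ _ hi.le le_rfl h
        omega
      · obtain ⟨i, hi, h⟩ := Finset.mem_image.1 h
        rw [Finset.mem_Icc] at hi
        rcases Nat.eq_zero_or_pos d with hd | hd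
        · rw [hd, ← f0] at h
          have := fi _ _ (by omega) (by omega) h
          omega
        · apply fF i (by omega)
          rw [h]; exact hF1m d hd le_rfl)
    (by
      intro h
      rcases Finset.mem_union.1 h with h | h
      · obtain ⟨i, hi, h⟩ := Finset.mem_image.1 h
        rw [Finset.mem_range] at hi
        exact hXy _ hi.le h
      · obtain ⟨i, hi, h⟩ := Finset.mem_image.1 h
        rw [Finset.mem_Icc] at hi
        rw [← fp] at h
        have := fi _ _ (by omega) le_rfl h
        omega)
  set H : ℕ → V := fun i => if i ≤ d then X i else h (i - d) with hH
  have H1 : ∀ i ≤ d, H i = X i := by intro i hi; simp [hH, hi]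
  have H2 : ∀ i, d ≤ i → H i = h (i - d) := by
    intro i hi
    rcases hi.lt_or_eq with h' | rfl
    · simp [hH, not_le.2 h']
    · rw [H1 _ le_rfl, ← h0]; simp
  refine ⟨f, H, ⟨fa, fi⟩, ⟨?_, ?_⟩, ?_, ?_, ?_⟩
  · intro i hi
    by_cases h' : i < d
    · rw [H1 i h'.le, H1 (i + 1) h']; exact hX1 i h'
    · rw [H2 i (by omega), H2 (i + 1) (by omega), show i + 1 - d = i - d + 1 by omega]
      exact ha (i - d) (by omega)
  · intro i j hi' hj' hij
    by_cases e1 : i < d <;> by_cases e2 : j < d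
    · rw [H1 i e1.le, H1 j e2.le] at hij
      exact hX2 _ _ e1.le e2.le hij
    · rw [H1 i e1.le, H2 j (by omega)] at hij
      exact absurd (hij ▸ hF2X i e1) (hF _ (by omega))
    · rw [H2 i (by omega), H1 j e2.le] at hij
      exact absurd (hij ▸ hF2X j e2) (hF _ (by omega))
    · rw [H2 i (by omega), H2 j (by omega)] at hij
      have := hi _ _ (by omega) (by omega) hij
      omega
  · rw [H1 0 (by omega), f0]
  · rw [H2 _ (by omega), fp, show p + 2 + d - d = p + 2 by omega, hp]
  · intro i j hi' hj1 hj2 hij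
    by_cases e1 : j ≤ d
    · rw [H1 j e1] at hij
      exact fF i hi' (hij ▸ hF1m j hj1 e1)
    · rw [H2 j (by omega)] at hij
      have hjF := hF (j - d) (by omega)
      rw [← hij] at hjF
      rcases Nat.eq_zero_or_pos i with rfl | hi0
      · rcases Nat.eq_zero_or_pos d with hd | hd
        · have hX0 : X 0 = h 0 := by rw [h0, hd]
          rw [f0, hX0] at hij
          have := hi _ _ (by omega) (by omega) hij
          omega
        · rw [f0] at hjF
          exact hjF (hF2X 0 hd)
      · rcases hi'.lt_or_eq with h' | h'
        · exact hjF (hF2f i hi0 (by omega))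
        · rw [h', fp, ← hp] at hij
          have := hi _ _ (by omega) (by omega) hij
          omega

lemma shift_col (m : ℕ) : ∀ (C : Type) [Fintype C], ∃ N : ℕ, ∀ f : (Fin (m + 1) → Fin N) → C,
    ∃ t : Fin (m + 2) → Fin N, StrictMono t ∧ f (fun i => t i.castSucc) = f (fun i => t i.succ) := by
  induction m with
  | zero =>
    intro C _
    refine ⟨Fintype.card C + 1, fun f => ?_⟩
    obtain ⟨a, b, hab, hf⟩ := Fintype.exists_ne_map_eq_of_card_lt
      (fun x : Fin (Fintype.card C + 1) => f (fun _ => x)) (by simp)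
    have key : ∀ a b : Fin (Fintype.card C + 1), a < b → f (fun _ => a) = f (fun _ => b) →
        ∃ t : Fin (0 + 2) → Fin (Fintype.card C + 1), StrictMono t ∧
          f (fun i => t i.castSucc) = f (fun i => t i.succ) := by
      intro a b hab hf
      refine ⟨fun i => if i = 0 then a else b, ?_, ?_⟩
      · rw [Fin.strictMono_iff_lt_succ]
        intro i
        have : i = 0 := Subsingleton.elim _ _
        subst this
        simpa using hab
      · have e1 : (fun i : Fin (0 + 1) => if i.castSucc = (0 : Fin (0 + 2)) then a else b)
            = fun _ => a := by
          funext i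
          obtain rfl : i = 0 := Subsingleton.elim (α := Fin 1) i 0
          simp
        have e2 : (fun i : Fin (0 + 1) => if i.succ = (0 : Fin (0 + 2)) then a else b)
            = fun _ => b := by
          funext i
          simp [Fin.succ_ne_zero]
        show f (fun i : Fin (0 + 1) => if i.castSucc = (0 : Fin (0 + 2)) then a else b) =
          f (fun i : Fin (0 + 1) => if i.succ = (0 : Fin (0 + 2)) then a else b)
        rw [e1, e2]
        exact hf
    rcases lt_or_gt_of_ne hab with h | h
    · exact key a b h hf
    · exact key b a h hf.symm
  | succ m ih =>
    intro C _
    obtain ⟨N, hN⟩ := ih (Finset C)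
    refine ⟨N, fun f => ?_⟩
    obtain ⟨t, ht, hg⟩ := hN (fun s => Finset.univ.filter (fun c => ∃ x : Fin N,
      StrictMono (Fin.snoc (α := fun _ => Fin N) s x) ∧ f (Fin.snoc (α := fun _ => Fin N) s x) = c))
    have h1 : Fin.snoc (α := fun _ => Fin N) (fun i => t (Fin.castSucc i)) (t (Fin.last _)) = t :=
      Fin.snoc_init_self (α := fun _ => Fin N) t
    have h2 : f t ∈ Finset.univ.filter (fun c => ∃ x : Fin N,
      StrictMono (Fin.snoc (α := fun _ => Fin N) (fun i => t (Fin.castSucc i)) x) ∧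
        f (Fin.snoc (α := fun _ => Fin N) (fun i => t (Fin.castSucc i)) x) = c) := by
      rw [Finset.mem_filter]
      exact ⟨Finset.mem_univ _, t (Fin.last _), by rw [h1]; exact ht, by rw [h1]⟩
    have h3 := hg ▸ h2
    obtain ⟨x, hx, hfx⟩ := (Finset.mem_filter.1 h3).2
    set t' : Fin (m + 1 + 2) → Fin N := Fin.snoc (α := fun _ => Fin N) t x with ht'
    have hstart : (fun i : Fin (m + 2) => t' i.castSucc) = t := by
      funext i
      simp [ht', Fin.snoc_castSucc]
    have htail : (fun i : Fin (m + 2) => t' i.succ) =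
        Fin.snoc (α := fun _ => Fin N) (fun i => t (Fin.succ i)) x := by
      funext i
      refine Fin.lastCases ?_ (fun j => ?_) i
      · rw [Fin.snoc_last, Fin.succ_last, ht', Fin.snoc_last]
      · rw [Fin.snoc_castSucc, Fin.succ_castSucc, ht', Fin.snoc_castSucc]
    refine ⟨t', ?_, ?_⟩
    · rw [Fin.strictMono_iff_lt_succ]
      intro i
      refine Fin.lastCases ?_ (fun j => ?_) i
      · have := hx (Fin.castSucc_lt_last (Fin.last m))
        rw [Fin.snoc_last, Fin.snoc_castSucc] at this
        rw [Fin.succ_last, ht', Fin.snoc_last, Fin.snoc_castSucc]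
        simpa using this
      · rw [Fin.succ_castSucc, ht', Fin.snoc_castSucc, Fin.snoc_castSucc]
        exact ht (Fin.castSucc_lt_succ)
    · rw [hstart, htail, hfx]

/-- Vertices of the extremal digraph. -/
abbrev NegV (d l N M : ℕ) : Type := (Fin (d + 1) → Fin N) ⊕ (ZMod l × (Fin N → Bool) × Fin M)

/-- Arcs of the extremal digraph. -/
def negE (d l N M : ℕ) : NegV d l N M → NegV d l N M → Prop
  | Sum.inl t, Sum.inl t' => ∃ s : Fin (d + 2) → Fin N, StrictMono s ∧
      t = (fun i => s i.castSucc) ∧ t' = (fun i => s i.succ)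
  | Sum.inl t, Sum.inr (i, X, _) =>
      i = 0 ∧ (StrictMono t → X (t 0) = true ∧ X (t (Fin.last d)) = false)
  | Sum.inr _, Sum.inl _ => False
  | Sum.inr (i, _, _), Sum.inr (j, _, _) => j = i + 1

section neg
variable {d l N M : ℕ}

lemma negE_strict_left {t t' : Fin (d + 1) → Fin N}
    (h : negE d l N M (Sum.inl t) (Sum.inl t')) : StrictMono t := by
  obtain ⟨s, hs, rfl, rfl⟩ := h
  exact hs.comp Fin.strictMono_castSucc

lemma negE_strict_right {t t' : Fin (d + 1) → Fin N}
    (h : negE d l N M (Sum.inl t) (Sum.inl t')) : StrictMono t' := by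
  obtain ⟨s, hs, rfl, rfl⟩ := h
  exact hs.comp Fin.strictMono_succ

lemma negE_lt {t t' : Fin (d + 1) → Fin N}
    (h : negE d l N M (Sum.inl t) (Sum.inl t')) : t 0 < t' 0 := by
  obtain ⟨s, hs, rfl, rfl⟩ := h
  exact hs (Fin.castSucc_lt_succ)

lemma negE_shift {t t' : Fin (d + 1) → Fin N}
    (h : negE d l N M (Sum.inl t) (Sum.inl t')) (i : ℕ) (hi : i + 1 < d + 1) :
    t' ⟨i, by omega⟩ = t ⟨i + 1, hi⟩ := by
  obtain ⟨s, hs, rfl, rfl⟩ := h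
  rfl

lemma negE_inr {W : ℕ → NegV d l N M} {m : ℕ} (hW : ∀ i < m, negE d l N M (W i) (W (i + 1)))
    {i : ℕ} {z : ZMod l} {q : (Fin N → Bool) × Fin M} (hi : W i = Sum.inr (z, q)) (j : ℕ) :
    i + j ≤ m → ∃ q', W (i + j) = Sum.inr (z + j, q') := by
  induction j with
  | zero => intro _; exact ⟨q, by simpa using hi⟩
  | succ j ih =>
    intro hj
    obtain ⟨q', hq'⟩ := ih (by omega)
    have h := hW (i + j) (by omega)
    rw [hq'] at h
    rcases hw : W (i + j + 1) with t | ⟨z', q''⟩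
    · rw [hw] at h; exact h.elim
    · rw [hw] at h
      have h' : z' = z + j + 1 := h
      exact ⟨q'', by rw [h', Nat.cast_add, Nat.cast_one, add_assoc]⟩

lemma negE_inl {W : ℕ → NegV d l N M} {m : ℕ} (hW : ∀ i < m, negE d l N M (W i) (W (i + 1)))
    {b : Fin (d + 1) → Fin N} (hm : W m = Sum.inl b) (i : ℕ) (hi : i ≤ m) :
    ∃ t, W i = Sum.inl t := by
  rcases hw : W i with t | ⟨z, q⟩
  · exact ⟨t, rfl⟩
  · obtain ⟨q', hq'⟩ := negE_inr hW hw (m - i) (by omega)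
    rw [show i + (m - i) = m by omega, hm] at hq'
    cases hq'

lemma negE_incr {W : ℕ → NegV d l N M} {m : ℕ} (hW : ∀ i < m, negE d l N M (W i) (W (i + 1)))
    {b : Fin (d + 1) → Fin N} (hm : W m = Sum.inl b) {i : ℕ} {t : Fin (d + 1) → Fin N}
    (ht : W i = Sum.inl t) (j : ℕ) : i + j + 1 ≤ m → ∃ t', W (i + j + 1) = Sum.inl t' ∧ t 0 < t' 0 := by
  induction j with
  | zero =>
    intro h
    obtain ⟨t', ht'⟩ := negE_inl hW hm (i + 1) h
    refine ⟨t', ht', ?_⟩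
    have := hW i (by omega)
    rw [ht, ht'] at this
    exact negE_lt this
  | succ j ih =>
    intro h
    obtain ⟨t1, ht1, h1⟩ := ih (by omega)
    obtain ⟨t', ht'⟩ := negE_inl hW hm (i + (j + 1) + 1) h
    refine ⟨t', ht', ?_⟩
    have := hW (i + j + 1) (by omega)
    rw [ht1] at this
    rw [show i + j + 1 + 1 = i + (j + 1) + 1 by omega, ht'] at this
    exact h1.trans (negE_lt this)

lemma negE_irr (hl : 2 ≤ l) (v : NegV d l N M) : ¬ negE d l N M v v := by
  rcases v with t | ⟨z, X, j⟩
  · intro h; exact lt_irrefl _ (negE_lt h)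
  · intro h
    have h' : z = z + 1 := h
    have : Fact (1 < l) := ⟨hl⟩
    simp at h'

lemma negE_no_closed {W : ℕ → NegV d l N M} {k : ℕ} (hk : 1 ≤ k) (hlk : ¬ l ∣ k)
    (hW : ∀ i < k, negE d l N M (W i) (W (i + 1))) : W k ≠ W 0 := by
  intro h
  rcases hw : W 0 with t | ⟨z, q⟩
  · obtain ⟨t', ht', hlt⟩ := negE_incr hW (h.trans hw) hw (k - 1) (by omega)
    rw [show 0 + (k - 1) + 1 = k by omega, h, hw] at ht'
    cases ht'
    exact lt_irrefl _ hlt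
  · obtain ⟨q', hq'⟩ := negE_inr hW hw k (by omega)
    rw [zero_add, h, hw] at hq'
    simp only [Sum.inr.injEq, Prod.mk.injEq] at hq'
    have h0 : ((k : ℕ) : ZMod l) = 0 := by simpa using hq'.1
    rw [ZMod.natCast_eq_zero_iff] at h0
    exact hlk h0

lemma negE_shift_walk {W : ℕ → NegV d l N M} {m : ℕ}
    (hW : ∀ i < m, negE d l N M (W i) (W (i + 1)))
    {b : Fin (d + 1) → Fin N} (hm : W m = Sum.inl b) {a : Fin (d + 1) → Fin N}
    (ha : W 0 = Sum.inl a) (j : ℕ) : j ≤ m → ∃ t, W j = Sum.inl t ∧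
      ∀ i (h : i + j < d + 1), t ⟨i, by omega⟩ = a ⟨i + j, h⟩ := by
  induction j with
  | zero => intro _; exact ⟨a, ha, fun i h => rfl⟩
  | succ j ih =>
    intro hj
    obtain ⟨t, ht, h⟩ := ih (by omega)
    obtain ⟨t', ht'⟩ := negE_inl hW hm (j + 1) hj
    refine ⟨t', ht', fun i hi => ?_⟩
    have := hW j (by omega)
    rw [ht, ht'] at this
    rw [negE_shift this i (by omega), h (i + 1) (by omega)]
    congr 2; omega

lemma negE_no_short {W : ℕ → NegV d l N M} (hd : 1 ≤ d) (hdl : d < l)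
    (hW : ∀ i < d + 1, negE d l N M (W i) (W (i + 1))) : ¬ negE d l N M (W 0) (W (d + 1)) := by
  intro hE
  rcases hw : W 0 with a | ⟨z, q⟩
  · rcases hw' : W (d + 1) with b | ⟨z, X, r⟩
    · obtain ⟨t1, ht1⟩ := negE_inl hW hw' 1 (by omega)
      obtain ⟨t', ht', hlt⟩ := negE_incr hW hw' ht1 (d - 1) (by omega)
      rw [show 1 + (d - 1) + 1 = d + 1 by omega, hw'] at ht'
      cases ht'
      have h1 := hW 0 (by omega)
      rw [hw, ht1] at h1
      rw [hw, hw'] at hE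
      have e1 := negE_shift h1 0 (by omega)
      have e2 := negE_shift hE 0 (by omega)
      rw [← e2] at e1
      exact absurd e1.symm (ne_of_gt hlt)
    · have hz : z = 0 := by
        rw [hw, hw'] at hE; exact hE.1
      have inv : ∀ i ≤ d, (∃ t, W i = Sum.inl t) ∨ ∃ j < i, ∃ q, W i = Sum.inr ((j : ZMod l), q) := by
        intro i
        induction i with
        | zero => intro _; exact Or.inl ⟨a, hw⟩
        | succ i ih =>
          intro hi
          rcases hwi : W (i + 1) with t | ⟨z', q'⟩
          · exact Or.inl ⟨t, rfl⟩
          · right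
            have h1 := hW i (by omega)
            rcases ih (by omega) with ⟨t, ht⟩ | ⟨j, hj, q, hq⟩
            · rw [ht, hwi] at h1
              have h2 : z' = 0 := h1.1
              exact ⟨0, by omega, q', by rw [h2]; simp⟩
            · rw [hq, hwi] at h1
              have h2 : z' = (j : ZMod l) + 1 := h1
              exact ⟨j + 1, by omega, q', by rw [h2]; push_cast; rfl⟩
      have hlast := hW d (by omega)
      rcases inv d le_rfl with ⟨b, hb⟩ | ⟨j, hj, q, hq⟩
      · have hW' : ∀ i < d, negE d l N M (W i) (W (i + 1)) := fun i hi => hW i (by omega)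
        obtain ⟨t, ht, hta⟩ := negE_shift_walk hW' hb hw d le_rfl
        rw [hb] at ht
        cases ht
        have h1 := hta 0 (by omega)
        obtain ⟨t1, ht1⟩ := negE_inl hW' hb 1 hd
        obtain ⟨t2, ht2⟩ := negE_inl hW' hb (d - 1) (by omega)
        have s1 := hW 0 (by omega)
        rw [hw, ht1] at s1
        have s2 := hW (d - 1) (by omega)
        rw [show d - 1 + 1 = d by omega, hb, ht2] at s2
        rw [hw, hw'] at hE
        rw [hb, hw'] at hlast
        have e1 := (hE.2 (negE_strict_left s1)).2
        have e2 := (hlast.2 (negE_strict_right s2)).1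
        have h3 : b 0 = a (Fin.last d) := by
          have : (⟨0 + d, by omega⟩ : Fin (d + 1)) = Fin.last d := by ext; simp
          rw [← this, ← h1]; rfl
        rw [h3, e1] at e2
        cases e2
      · rw [hq, hw'] at hlast
        have h2 : z = (j : ZMod l) + 1 := hlast
        rw [hz] at h2
        have h3 : ((j + 1 : ℕ) : ZMod l) = 0 := by push_cast; exact h2.symm
        rw [ZMod.natCast_eq_zero_iff] at h3
        have := Nat.le_of_dvd (by omega) h3
        omega
  · obtain ⟨q', hq'⟩ := negE_inr hW hw (d + 1) (by omega)
    rw [zero_add] at hq'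
    rw [hw, hq'] at hE
    have h2 : z + ((d + 1 : ℕ) : ZMod l) = z + 1 := hE
    have h3 : ((d : ℕ) : ZMod l) = 0 := by
      push_cast at h2
      have := add_left_cancel h2
      simpa using this
    rw [ZMod.natCast_eq_zero_iff] at h3
    have := Nat.le_of_dvd (by omega) h3
    omega

lemma negE_deg [NeZero l] (hd : 1 ≤ d) (v : NegV d l N M) :
    2 ^ N * M ≤ 4 * Nat.card {u // negE d l N M v u} := by
  have h0 : 2 ^ N * M = Fintype.card ((Fin N → Bool) × Fin M) := by simp
  have h1 : ∀ K : (Fin N → Bool) × Fin M → (Bool × Bool) × {u // negE d l N M v u},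
      Function.Injective K → 2 ^ N * M ≤ 4 * Nat.card {u // negE d l N M v u} := by
    intro K hK
    have := Fintype.card_le_of_injective K hK
    rw [← h0, Fintype.card_prod] at this
    rw [Nat.card_eq_fintype_card]
    simpa using this
  rcases v with t | ⟨z, X, j⟩
  · by_cases ht : StrictMono t
    · have hne : t 0 ≠ t (Fin.last d) := by
        apply ne_of_lt
        apply ht
        rw [Fin.lt_def]; simp; omega
      refine h1 (fun x => ((x.1 (t 0), x.1 (t (Fin.last d))),
        ⟨Sum.inr (0, Function.update (Function.update x.1 (t 0) true) (t (Fin.last d)) false, x.2),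
          rfl, fun _ => ⟨?_, ?_⟩⟩)) ?_
      · rw [Function.update_of_ne hne, Function.update_self]
      · rw [Function.update_self]
      · rintro ⟨X, i⟩ ⟨X', i'⟩ h
        have h2 : X (t 0) = X' (t 0) := congrArg (fun y => y.1.1) h
        have h3 : X (t (Fin.last d)) = X' (t (Fin.last d)) := congrArg (fun y => y.1.2) h
        have h6 := Sum.inr.inj (congrArg (fun y => y.2.1) h)
        have h4 := congrArg (fun y => y.2.1) h6
        have h5 := congrArg (fun y => y.2.2) h6
        refine Prod.ext ?_ h5
        funext x
        by_cases e1 : x = t (Fin.last d)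
        · rw [e1]; exact h3
        by_cases e2 : x = t 0
        · rw [e2]; exact h2
        have := congrFun h4 x
        simpa [Function.update_of_ne e1, Function.update_of_ne e2] using this
    · refine h1 (fun x => ((true, true), ⟨Sum.inr (0, x.1, x.2), rfl, fun h => absurd h ht⟩)) ?_
      rintro ⟨X, i⟩ ⟨X', i'⟩ h
      exact congrArg (fun y => y.2) (Sum.inr.inj (congrArg (fun y => y.2.1) h))
  · refine h1 (fun x => ((true, true), ⟨Sum.inr (z + 1, x.1, x.2), rfl⟩)) ?_
    rintro ⟨X, i⟩ ⟨X', i'⟩ h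
    exact congrArg (fun y => y.2) (Sum.inr.inj (congrArg (fun y => y.2.1) h))

end neg

lemma neg_exists (d l : ℕ) (hd : 1 ≤ d) (hl : 2 ≤ l) : ∃ ε : ℝ, 0 < ε ∧ ∀ c : ℕ,
    ∃ (n : ℕ) (E : Fin n → Fin n → Prop), (∀ v, ¬ E v v) ∧
      (c : ℕ∞) ≤ (SimpleGraph.fromRel E).chromaticNumber ∧
      (∀ v : Fin n, ε * (n : ℝ) ≤ (Nat.card {u : Fin n // E v u} : ℝ)) ∧
      (∀ k, 1 ≤ k → ¬ l ∣ k → ∀ W : ℕ → Fin n, (∀ i < k, E (W i) (W (i + 1))) → W k ≠ W 0) ∧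
      (d < l → ∀ W : ℕ → Fin n, (∀ i < d + 1, E (W i) (W (i + 1))) → ¬ E (W 0) (W (d + 1))) := by
  have : NeZero l := ⟨by omega⟩
  refine ⟨1 / (4 * (l + 1)), by positivity, fun c => ?_⟩
  obtain ⟨N, hN⟩ := shift_col d (Fin c)
  set M := N ^ (d + 1) + 1 with hM
  set V := NegV d l N M with hV
  set n := Fintype.card V with hn
  let e : V ≃ Fin n := Fintype.equivFin V
  have hcard : n = N ^ (d + 1) + l * (2 ^ N * M) := by
    show Fintype.card (NegV d l N M) = _
    simp [NegV, ZMod.card]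
  refine ⟨n, fun i j => negE d l N M (e.symm i) (e.symm j), fun v => negE_irr hl _, ?_, ?_, ?_, ?_⟩
  · by_contra hlt
    rw [not_le] at hlt
    have hcol : (SimpleGraph.fromRel fun i j => negE d l N M (e.symm i) (e.symm j)).Colorable c :=
      SimpleGraph.chromaticNumber_le_iff_colorable.1 hlt.le
    obtain ⟨f⟩ := hcol
    obtain ⟨s, hs, hfs⟩ := hN (fun t => f (e (Sum.inl t)))
    have harc : negE d l N M (Sum.inl fun i => s i.castSucc) (Sum.inl fun i => s i.succ) :=
      ⟨s, hs, rfl, rfl⟩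
    refine f.valid (v := e (Sum.inl fun i => s i.castSucc)) (w := e (Sum.inl fun i => s i.succ))
      ?_ hfs
    rw [SimpleGraph.fromRel_adj]
    refine ⟨fun h => ?_, Or.inl (by simpa using harc)⟩
    have h' := e.injective h
    rw [h'] at harc
    exact negE_irr hl _ harc
  · intro v
    have h1 := negE_deg (M := M) hd (e.symm v)
    have h2 : Nat.card {u : Fin n // negE d l N M (e.symm v) (e.symm u)} =
        Nat.card {u : V // negE d l N M (e.symm v) u} :=
      Nat.card_congr (e.symm.subtypeEquiv fun _ => Iff.rfl)
    rw [h2]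
    have h3 : n ≤ (l + 1) * (2 ^ N * M) := by
      have : 1 * M ≤ 2 ^ N * M := Nat.mul_le_mul_right _ Nat.one_le_two_pow
      rw [hcard, add_mul]
      omega
    have h4 : n ≤ (l + 1) * (4 * Nat.card {u : V // negE d l N M (e.symm v) u}) :=
      h3.trans (Nat.mul_le_mul_left _ h1)
    have h5 : (n : ℝ) ≤ (l + 1) * (4 * (Nat.card {u : V // negE d l N M (e.symm v) u} : ℝ)) := by
      exact_mod_cast h4
    rw [div_mul_eq_mul_div, one_mul, div_le_iff₀ (by positivity)]
    linarith
  · intro k hk hlk W hW h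
    exact negE_no_closed (W := fun i => e.symm (W i)) hk hlk hW (congrArg e.symm h)
  · intro hdl W hW
    exact negE_no_short (W := fun i => e.symm (W i)) hd hdl hW

lemma contains_of_cyc {k : ℕ} [NeZero k] (_hk : 2 ≤ k) {o : ZMod k → Bool} {V : Type}
    {E : V → V → Prop} (s : ZMod k) {g : ℕ → V}
    (h : IsCyc E (fun j : ℕ => o (s + (j : ZMod k))) k g) : ContainsDigraph E (cycleOrient o) := by
  obtain ⟨h1, h2, h3⟩ := h
  have key : ∀ u : ZMod k, arcB E (o u) (g ((u - s).val)) (g ((u + 1 - s).val)) := by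
    intro u
    have hlt := ZMod.val_lt (u - s)
    have ha := h1 _ hlt
    have hu : s + (((u - s).val : ℕ) : ZMod k) = u := by
      rw [ZMod.natCast_zmod_val]; ring
    have hv : g ((u + 1 - s).val) = g ((u - s).val + 1) := by
      have e : u + 1 - s = (((u - s).val + 1 : ℕ) : ZMod k) := by
        push_cast
        rw [ZMod.natCast_zmod_val]; ring
      rw [e, ZMod.val_natCast]
      rcases Nat.lt_or_ge ((u - s).val + 1) k with hh | hh
      · rw [Nat.mod_eq_of_lt hh]
      · have : (u - s).val + 1 = k := by omega
        rw [this, Nat.mod_self, h2]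
    simp only [hu] at ha
    rw [hv]
    exact ha
  refine ⟨fun u => g ((u - s).val), ?_, ?_⟩
  · intro u v huv
    have := h3 _ _ (ZMod.val_lt (u - s)) (ZMod.val_lt (v - s)) huv
    have := ZMod.val_injective k this
    exact sub_left_injective this
  · rintro u v (⟨hu, rfl⟩ | ⟨hv, rfl⟩)
    · have := key u
      rw [hu] at this
      simpa [arcB] using this
    · have := key v
      rw [hv] at this
      simpa [arcB] using this

lemma not_colSet {n : ℕ} {E : Fin n → Fin n → Prop} {c : ℕ}
    (h : ((c + 1 : ℕ) : ℕ∞) ≤ (SimpleGraph.fromRel E).chromaticNumber) :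
    ¬ ColSet E Finset.univ c := by
  rintro ⟨f, hf1, hf2⟩
  have hcol : (SimpleGraph.fromRel E).Colorable c := by
    refine ⟨SimpleGraph.Coloring.mk (fun v => (⟨f v, hf1 v (Finset.mem_univ _)⟩ : Fin c)) ?_⟩
    intro v w hvw heq
    rw [SimpleGraph.fromRel_adj] at hvw
    have heq' : f v = f w := congrArg Fin.val heq
    rcases hvw.2 with h' | h'
    · exact hf2 v (Finset.mem_univ _) w (Finset.mem_univ _) h' heq'
    · exact hf2 w (Finset.mem_univ _) v (Finset.mem_univ _) h' heq'.symm
  have := h.trans (SimpleGraph.chromaticNumber_le_iff_colorable.2 hcol)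
  have h2 : c + 1 ≤ c := by exact_mod_cast this
  omega

lemma card_outF {V : Type} [Fintype V] (E : V → V → Prop) (v : V) :
    Nat.card {u : V // E v u} = (outF E v).card := by
  rw [Nat.card_eq_fintype_card, Fintype.card_subtype]
  congr 1

section comb
variable {k : ℕ} [NeZero k] (o : ZMod k → Bool)

/-- Indices followed by a sink. -/
def sinkF : Finset (ZMod k) := Finset.univ.filter fun i => o i = true ∧ o (i + 1) = false

/-- Indices followed by a source. -/
def srcF : Finset (ZMod k) := Finset.univ.filter fun i => o i = false ∧ o (i + 1) = true

lemma sink_card_eq : (sinkF o).card = (srcF o).card := by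
  have h1 : (Finset.univ.filter fun i => o i = true).card =
      (Finset.univ.filter fun i => o i = true ∧ o (i + 1) = true).card + (sinkF o).card := by
    rw [sinkF, ← Finset.card_union_of_disjoint]
    · congr 1
      ext i
      cases h : o (i + 1) <;> simp [h]
    · rw [Finset.disjoint_left]
      intro i; simp; intros; simp_all
  have h2 : (Finset.univ.filter fun i => o (i + 1) = true).card =
      (Finset.univ.filter fun i => o i = true ∧ o (i + 1) = true).card + (srcF o).card := by
    rw [srcF, ← Finset.card_union_of_disjoint]
    · congr 1
      ext i
      cases h : o i <;> simp [h]
    · rw [Finset.disjoint_left]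
      intro i; simp; intros; simp_all
  have h3 : (Finset.univ.filter fun i => o (i + 1) = true).card =
      (Finset.univ.filter fun i => o i = true).card := by
    apply Finset.card_bij (fun i _ => i + 1)
    · intro i; simp
    · intro i _ j _ h; exact add_right_cancel h
    · intro j hj
      exact ⟨j - 1, by simpa using hj, by ring⟩
  omega

lemma change_ncard : {i : ZMod k | o i ≠ o (i + 1)}.ncard = 2 * (sinkF o).card := by
  have h : {i : ZMod k | o i ≠ o (i + 1)} = ((sinkF o ∪ srcF o : Finset (ZMod k)) : Set (ZMod k)) := by
    ext i
    cases h : o i <;> cases h' : o (i + 1) <;> simp [sinkF, srcF, h, h']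
  rw [h, Set.ncard_coe_finset, Finset.card_union_of_disjoint, ← sink_card_eq]
  · omega
  · rw [Finset.disjoint_left]
    intro i; simp only [sinkF, srcF, Finset.mem_filter]
    rintro ⟨_, h, _⟩ ⟨_, h', _⟩
    rw [h] at h'; cases h'

lemma const_of_step (h : ∀ i, o i = o (i + 1)) (i : ZMod k) : o i = o 0 := by
  have : ∀ j : ℕ, o (j : ZMod k) = o 0 := by
    intro j
    induction j with
    | zero => simp
    | succ j ih => rw [Nat.cast_succ, ← h, ih]
  rw [← ZMod.natCast_zmod_val i]
  exact this _

lemma blockCount_nonconst (h : ¬ ∀ i, o i = o 0) :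
    blockCount o = 2 * (sinkF o).card ∧ 1 ≤ (sinkF o).card := by
  constructor
  · rw [blockCount, if_neg h, change_ncard]
  · by_contra h0
    apply h
    apply const_of_step
    intro i
    by_contra hne
    have h1 : {i : ZMod k | o i ≠ o (i + 1)}.ncard = 0 := by rw [change_ncard]; omega
    rw [Set.ncard_eq_zero] at h1
    have : i ∈ {i : ZMod k | o i ≠ o (i + 1)} := hne
    rw [h1] at this
    exact this

lemma cast_inj_lt {i j : ℕ} (hi : i < k) (hj : j < k) (h : (i : ZMod k) = j) : i = j := by
  rw [ZMod.natCast_eq_natCast_iff'] at h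
  rwa [Nat.mod_eq_of_lt hi, Nat.mod_eq_of_lt hj] at h

lemma cast_pred : ((k - 1 : ℕ) : ZMod k) = -1 := by
  have : 1 ≤ k := Nat.one_le_iff_ne_zero.2 (NeZero.ne k)
  rw [Nat.cast_sub this]; simp

lemma three_blocks (h : 3 ≤ blockCount o) : ∃ (s : ZMod k) (a b : ℕ), k = a + b + 4 ∧
    o s = false ∧ o (s + ((a + 1 : ℕ) : ZMod k)) = true ∧ o (s + ((a + 2 : ℕ) : ZMod k)) = false ∧
    o (s + ((a + b + 3 : ℕ) : ZMod k)) = true := by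
  have hnc : ¬ ∀ i, o i = o 0 := by
    intro hc
    rw [blockCount, if_pos hc] at h
    omega
  have h2 := (blockCount_nonconst o hnc).1
  obtain ⟨i1, hi1, i2, hi2, hne⟩ := Finset.one_lt_card.1 (show 1 < (sinkF o).card by omega)
  simp only [sinkF, Finset.mem_filter, Finset.mem_univ, true_and] at hi1 hi2
  set s := i1 + 1 with hs
  set m := (i2 - s).val with hm
  have hmk : m < k := ZMod.val_lt _
  have e2 : s + (m : ZMod k) = i2 := by rw [hm, ZMod.natCast_zmod_val]; ring
  have e1 : s + ((k - 1 : ℕ) : ZMod k) = i1 := by rw [cast_pred, hs]; ring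
  have m0 : m ≠ 0 := by
    intro h0
    rw [h0] at e2
    rw [← e2] at hi2
    simp [hi1.2] at hi2
  have m1 : m ≠ k - 1 := by
    intro h0
    rw [h0, e1] at e2
    exact hne e2
  have e3 : s + ((m + 1 : ℕ) : ZMod k) = i2 + 1 := by rw [← e2]; push_cast; ring
  have m2 : m + 1 ≠ k - 1 := by
    intro h0
    rw [h0, e1] at e3
    rw [← e3, hi1.1] at hi2
    simp at hi2
  refine ⟨s, m - 1, k - m - 3, by omega, hi1.2, ?_, ?_, ?_⟩
  · rw [show m - 1 + 1 = m by omega, e2]; exact hi2.1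
  · rw [show m - 1 + 2 = m + 1 by omega, e3]; exact hi2.2
  · rw [show m - 1 + (k - m - 3) + 3 = k - 1 by omega, e1]; exact hi1.1

lemma two_blocks (h : blockCount o = 2) (hs : ¬ hasShortBlock o) : ∃ (r : ZMod k) (a b : ℕ),
    k = a + b ∧ 2 ≤ a ∧ 2 ≤ b ∧ (∀ j : ℕ, j < a → o (r + (j : ZMod k)) = true) ∧
    (∀ j : ℕ, a ≤ j → j < a + b → o (r + (j : ZMod k)) = false) := by
  have hnc : ¬ ∀ i, o i = o 0 := by
    intro hc
    rw [blockCount, if_pos hc] at h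
    omega
  have h2 := (blockCount_nonconst o hnc).1
  have hA : (sinkF o).card = 1 := by omega
  have hB : (srcF o).card = 1 := by rw [← sink_card_eq, hA]
  obtain ⟨i, hi⟩ := Finset.card_eq_one.1 hA
  obtain ⟨r0, hr0⟩ := Finset.card_eq_one.1 hB
  have hA' : ∀ x, (o x = true ∧ o (x + 1) = false) ↔ x = i := by
    intro x
    rw [← Finset.mem_singleton (a := i), ← hi]
    simp [sinkF]
  have hB' : ∀ x, (o x = false ∧ o (x + 1) = true) ↔ x = r0 := by
    intro x
    rw [← Finset.mem_singleton (a := r0), ← hr0]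
    simp [srcF]
  obtain ⟨hi1, hi2⟩ := (hA' i).2 rfl
  obtain ⟨hr1, hr2⟩ := (hB' r0).2 rfl
  set r := r0 + 1 with hr
  set m := (i - r).val with hm
  have hmk : m < k := ZMod.val_lt _
  have em : r + (m : ZMod k) = i := by rw [hm, ZMod.natCast_zmod_val]; ring
  have em1 : r + ((m + 1 : ℕ) : ZMod k) = i + 1 := by rw [← em]; push_cast; ring
  have ek : r + ((k - 1 : ℕ) : ZMod k) = r0 := by rw [cast_pred, hr]; ring
  have hT : ∀ j : ℕ, j ≤ m → o (r + (j : ZMod k)) = true := by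
    intro j
    induction j with
    | zero => intro _; simpa using hr2
    | succ j ih =>
      intro hj
      have ihj := ih (by omega)
      by_contra hF
      rw [Bool.not_eq_true, Nat.cast_succ, ← add_assoc] at hF
      have := (hA' _).1 ⟨ihj, hF⟩
      rw [← em] at this
      have := cast_inj_lt (by omega) hmk (add_left_cancel this)
      omega
  have hF : ∀ j : ℕ, m + 1 + j < k → o (r + ((m + 1 + j : ℕ) : ZMod k)) = false := by
    intro j
    induction j with
    | zero => intro _; rw [add_zero, em1]; exact hi2
    | succ j ih =>
      intro hj
      have ihj := ih (by omega)
      by_contra hF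
      rw [Bool.not_eq_false, ← add_assoc, Nat.cast_succ, ← add_assoc] at hF
      have := (hB' _).1 ⟨ihj, hF⟩
      rw [← ek] at this
      have := cast_inj_lt (by omega) (by omega) (add_left_cancel this)
      omega
  have m1 : m ≠ k - 1 := by
    intro h0
    rw [h0, ek] at em
    rw [em, hi1] at hr1
    cases hr1
  have m0 : m ≠ 0 := by
    intro h0
    apply hs
    refine ⟨r0, ?_, ?_⟩
    · rw [hr1]; show false ≠ o r; rw [hr2]; simp
    · show o r ≠ _
      have : r0 + 2 = i + 1 := by
        rw [← em, h0, hr]; push_cast; ring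
      rw [this, hi2, hr2]; simp
  have m2 : m + 1 ≠ k - 1 := by
    intro h0
    apply hs
    refine ⟨i, ?_, ?_⟩
    · rw [hi1, hi2]; simp
    · have : i + 2 = r := by
        rw [h0, ek] at em1
        rw [hr, em1]; ring
      rw [this, hi2, hr2]; simp
  refine ⟨r, m + 1, k - (m + 1), by omega, by omega, by omega, fun j hj => hT j (by omega), ?_⟩
  intro j hj hj'
  have := hF (j - (m + 1)) (by omega)
  rwa [show m + 1 + (j - (m + 1)) = j by omega] at this

lemma short_block (hnc : ¬ ∀ i, o i = o 0) (h : ¬ 3 ≤ blockCount o) (hs : hasShortBlock o) :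
    ∃ i, o i ≠ o (i + 1) ∧ o (i + 1) ≠ o (i + 2) ∧
      ∀ j : ℕ, j < k - 1 → o (i + 2 + (j : ZMod k)) = o (i + 2) := by
  obtain ⟨h2, h1⟩ := blockCount_nonconst o hnc
  obtain ⟨i, hi, hi'⟩ := hs
  have hU : {i : ZMod k | o i ≠ o (i + 1)}.ncard = 2 := by rw [change_ncard]; omega
  have hne : i ≠ i + 1 := fun h => hi (congrArg o h)
  have hsub : ({i, i + 1} : Set (ZMod k)) = {i : ZMod k | o i ≠ o (i + 1)} := by
    apply Set.eq_of_subset_of_ncard_le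
    · rintro x (rfl | rfl)
      · exact hi
      · show o (i + 1) ≠ o (i + 1 + 1)
        rw [show i + 1 + 1 = i + 2 by ring]; exact hi'
    · rw [hU, Set.ncard_pair hne]
    · exact Set.toFinite _
  refine ⟨i, hi, hi', ?_⟩
  intro j
  induction j with
  | zero => intro _; simp
  | succ j ih =>
    intro hj
    rw [← ih (by omega), Nat.cast_succ, ← add_assoc]
    by_contra hc
    have hmem : i + 2 + (j : ZMod k) ∈ {i : ZMod k | o i ≠ o (i + 1)} := fun h => hc h.symm
    rw [← hsub] at hmem
    have e1 : i + 2 + ((k - 1 : ℕ) : ZMod k) = i + 1 := by rw [cast_pred]; ring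
    have e2 : i + 2 + ((k - 2 : ℕ) : ZMod k) = i := by
      have : ((k - 2 : ℕ) : ZMod k) + 1 = ((k - 1 : ℕ) : ZMod k) := by
        rw [← Nat.cast_succ]; congr 1; omega
      rw [cast_pred] at this
      have h3 : ((k - 2 : ℕ) : ZMod k) = -2 := by
        rw [eq_sub_of_add_eq this]; ring
      rw [h3]; ring
    rcases hmem with hm | hm
    · have := hm.trans e2.symm
      have := cast_inj_lt (by omega) (by omega) (add_left_cancel this)
      omega
    · have hm : i + 2 + (j : ZMod k) = i + 1 := hm
      have := hm.trans e1.symm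
      have := cast_inj_lt (by omega) (by omega) (add_left_cancel this)
      omega

end comb

lemma pos_three {k : ℕ} [NeZero k] (hk : 2 ≤ k) {o : ZMod k → Bool} (h : 3 ≤ blockCount o)
    {ε : ℝ} (hε : 0 < ε) : ∃ c : ℕ, 1 ≤ c ∧
      ∀ (n : ℕ) (E : Fin n → Fin n → Prop), (∀ v, ¬ E v v) →
        (c : ℕ∞) ≤ (SimpleGraph.fromRel E).chromaticNumber →
        (∀ v : Fin n, ε * (n : ℝ) ≤ (Nat.card {u : Fin n // E v u} : ℝ)) →
        ContainsDigraph E (cycleOrient o) := by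
  obtain ⟨s, a, b, hkab, p0, p1, p2, p3⟩ := three_blocks o h
  obtain ⟨c, hc⟩ := caseA (p := fun j : ℕ => o (s + (j : ZMod k))) (a := a) (b := b)
    (by simpa using p0) p1 p2 p3 hε
  refine ⟨c + 1, by omega, fun n E irr hchi hdeg => ?_⟩
  obtain ⟨g, hg⟩ := hc n E irr (not_colSet hchi) (fun v => by rw [← card_outF]; exact hdeg v)
  rw [← hkab] at hg
  exact contains_of_cyc hk s hg

lemma pos_two {k : ℕ} [NeZero k] (hk : 2 ≤ k) {o : ZMod k → Bool} (h : blockCount o = 2)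
    (hs : ¬ hasShortBlock o)
    {ε : ℝ} (hε : 0 < ε) : ∃ c : ℕ, 1 ≤ c ∧
      ∀ (n : ℕ) (E : Fin n → Fin n → Prop), (∀ v, ¬ E v v) →
        (c : ℕ∞) ≤ (SimpleGraph.fromRel E).chromaticNumber →
        (∀ v : Fin n, ε * (n : ℝ) ≤ (Nat.card {u : Fin n // E v u} : ℝ)) →
        ContainsDigraph E (cycleOrient o) := by
  obtain ⟨r, a, b, hkab, ha, hb, hT, hF⟩ := two_blocks o h hs
  obtain ⟨c, hc⟩ := two_paths (min a b - 2) (max a b - min a b) hε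
  refine ⟨c + 1, by omega, fun n E irr hchi hdeg => ?_⟩
  obtain ⟨f, h, hf, hh, h0, h1, hd⟩ := hc n (Fintype.card_fin n) E irr (not_colSet hchi)
    (fun v => by rw [← card_outF]; exact hdeg v)
  have key : ∃ g, IsCyc E (fun j : ℕ => o (r + (j : ZMod k))) (a + b) g := by
    rcases le_total a b with hab | hab
    · rw [min_eq_left hab, max_eq_right hab, show a - 2 + 2 = a by omega,
        show a + (b - a) = b by omega] at *
      exact glueB (by omega) (by omega) hT hF hf hh h0 h1 hd
    · rw [min_eq_right hab, max_eq_left hab, show b - 2 + 2 = b by omega,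
        show b + (a - b) = a by omega] at *
      refine glueB (by omega) (by omega) hT hF hh hf h0.symm h1.symm ?_
      intro i j hi hj hjb heq
      rcases Nat.eq_zero_or_pos i with rfl | hi0
      · rw [← h0] at heq
        have := hf.2 _ _ (by omega) (by omega) heq
        omega
      rcases Nat.lt_or_ge i a with hia | hia
      · exact hd j i (by omega) hi0 hia heq.symm
      · have : i = a := by omega
        rw [this, ← h1] at heq
        have := hf.2 _ _ (by omega) (by omega) heq
        omega
  obtain ⟨g, hg⟩ := key
  rw [← hkab] at hg
  exact contains_of_cyc hk r hg

lemma neg_const {k : ℕ} [NeZero k] (hk : 2 ≤ k) {o : ZMod k → Bool} (hc : ∀ i, o i = o 0)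
    (h : ∀ ε : ℝ, 0 < ε → ∃ c : ℕ, 1 ≤ c ∧
        ∀ (n : ℕ) (E : Fin n → Fin n → Prop), (∀ v, ¬ E v v) →
          (c : ℕ∞) ≤ (SimpleGraph.fromRel E).chromaticNumber →
          (∀ v : Fin n, ε * (n : ℝ) ≤ (Nat.card {u : Fin n // E v u} : ℝ)) →
          ContainsDigraph E (cycleOrient o)) : False := by
  obtain ⟨ε, hε, hneg⟩ := neg_exists 1 (k + 1) le_rfl (by omega)
  obtain ⟨c, -, hcc⟩ := h ε hε
  obtain ⟨n, E, irr, hchi, hdeg, hclosed, -⟩ := hneg c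
  obtain ⟨f, -, hf⟩ := hcc n E irr hchi hdeg
  have hnd : ¬ (k + 1) ∣ k := fun hd => by
    have := Nat.le_of_dvd (by omega) hd
    omega
  cases h0 : o 0 with
  | true =>
    refine hclosed k (by omega) hnd (fun i => f (i : ZMod k)) ?_ (by simp)
    intro i _
    apply hf
    left
    exact ⟨by rw [hc, h0], by push_cast; rfl⟩
  | false =>
    refine hclosed k (by omega) hnd (fun i => f (-(i : ZMod k))) ?_ (by simp)
    intro i _
    apply hf
    right
    exact ⟨by rw [hc, h0], by push_cast; ring⟩

lemma neg_short {k : ℕ} [NeZero k] {o : ZMod k → Bool}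
    (hC : Function.Injective (cycleArc o)) (hnc : ¬ ∀ i, o i = o 0)
    (h3 : ¬ 3 ≤ blockCount o) (hs : hasShortBlock o)
    (h : ∀ ε : ℝ, 0 < ε → ∃ c : ℕ, 1 ≤ c ∧
        ∀ (n : ℕ) (E : Fin n → Fin n → Prop), (∀ v, ¬ E v v) →
          (c : ℕ∞) ≤ (SimpleGraph.fromRel E).chromaticNumber →
          (∀ v : Fin n, ε * (n : ℝ) ≤ (Nat.card {u : Fin n // E v u} : ℝ)) →
          ContainsDigraph E (cycleOrient o)) : False := by
  obtain ⟨i, hi, hi', hj⟩ := short_block o hnc h3 hs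
  have hk3 : 3 ≤ k := by
    by_contra hlt
    have hk0 := NeZero.ne k
    have h11 : i + 1 + 1 = i := by
      have : k = 1 ∨ k = 2 := by omega
      rcases this with rfl | rfl
      · exact Subsingleton.elim _ _
      · have : ∀ x : ZMod 2, x + 1 + 1 = x := by decide
        exact this i
    have hne : i ≠ i + 1 := fun h => hi (congrArg o h)
    apply hne
    apply hC
    cases h0 : o i <;> cases h1 : o (i + 1) <;> simp_all [cycleArc]
  obtain ⟨ε, hε, hneg⟩ := neg_exists (k - 2) (k + 1) (by omega) (by omega)
  obtain ⟨c, -, hcc⟩ := h ε hε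
  obtain ⟨n, E, irr, hchi, hdeg, -, hno⟩ := hneg c
  obtain ⟨f, -, hf⟩ := hcc n E irr hchi hdeg
  have hno' := hno (by omega)
  rw [show k - 2 + 1 = k - 1 by omega] at hno'
  have hk2 : ((k - 2 : ℕ) : ZMod k) = -2 := by
    rw [Nat.cast_sub (by omega)]; simp
  cases h1 : o (i + 1) with
  | true =>
    have h2 : o (i + 2) = false := by
      cases h2 : o (i + 2)
      · rfl
      · rw [h1, h2] at hi'; exact absurd rfl hi'
    refine hno' (fun j => f (i + 1 - (j : ZMod k))) ?_ ?_
    · intro j hjk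
      apply hf
      right
      refine ⟨?_, by push_cast; ring⟩
      have := hj (k - 2 - j) (by omega)
      rw [Nat.cast_sub (by omega), hk2, h2] at this
      rw [← this]
      congr 1
      push_cast; ring
    · apply hf
      left
      refine ⟨by simpa using h1, ?_⟩
      rw [cast_pred]; push_cast; ring
  | false =>
    have h2 : o (i + 2) = true := by
      cases h2 : o (i + 2)
      · rw [h1, h2] at hi'; exact absurd rfl hi'
      · rfl
    refine hno' (fun j => f (i + 2 + (j : ZMod k))) ?_ ?_
    · intro j hjk
      apply hf
      left
      refine ⟨?_, by push_cast; ring⟩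
      rw [hj j hjk, h2]
    · apply hf
      right
      have e : i + 2 + ((k - 1 : ℕ) : ZMod k) = i + 1 := by rw [cast_pred]; ring
      rw [e]
      refine ⟨h1, ?_⟩
      push_cast; ring

end Helpers

/-- **Main theorem.** For `k ≥ 2` and `C` an orientation of the `k`-cycle (given by
`o : ZMod k → Bool`, a genuine digraph without parallel arcs), the following are
equivalent: (1) for every `ε > 0` there is a constant `c ≥ 1` such that every digraph
without loops or parallel arcs with chromatic number at least `c` and minimum out-degree
at least `ε·|V(D)|` contains `C` as a subdigraph; (2) `C` consists of at least three
blocks, or of exactly two blocks both of length at least two. -/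
theorem orientation_of_cycle_chromatic_threshold_iff
    (k : ℕ) (hk : 2 ≤ k) (o : ZMod k → Bool)
    (hC : Function.Injective (cycleArc o)) :
    (∀ ε : ℝ, 0 < ε → ∃ c : ℕ, 1 ≤ c ∧
        ∀ (n : ℕ) (E : Fin n → Fin n → Prop), (∀ v, ¬ E v v) →
          (c : ℕ∞) ≤ (SimpleGraph.fromRel E).chromaticNumber →
          (∀ v : Fin n, ε * (n : ℝ) ≤ (Nat.card {u : Fin n // E v u} : ℝ)) →
          ContainsDigraph E (cycleOrient o)) ↔
      (3 ≤ blockCount o ∨ (blockCount o = 2 ∧ ¬ hasShortBlock o)) := by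
  haveI : NeZero k := ⟨by omega⟩
  constructor
  · intro h1
    by_contra h2
    by_cases hc : ∀ i, o i = o 0
    · exact neg_const hk hc h1
    · refine neg_short hC hc (fun h => h2 (Or.inl h)) ?_ h1
      by_contra hs
      obtain ⟨e1, e2⟩ := blockCount_nonconst o hc
      by_cases h3 : 3 ≤ blockCount o
      · exact h2 (Or.inl h3)
      · exact h2 (Or.inr ⟨by omega, hs⟩)
  · rintro (h | ⟨h, hs⟩) ε hε
    · exact pos_three hk h hε
    · exact pos_two hk h hs hε
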